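/- arXiv:2512.06797 — 5 statements merged into one kernel-verified Lean document; each statement's English description precedes it below -/
import Mathlib

section
/- Let α₀ and α₁ be probability measures on ℝ^d with finite second moments, let X₀ and X₁ be independent random vectors with X₀ ∼ α₀ and X₁ ∼ α₁, and for t ∈ [0,1] let α_t denote the law of (1−t)X₀ + tX₁. For t ∈ (0,1) let v_t : ℝ^d → ℝ^d be a Borel version of the conditional expectation v_t(z) = E[X₁ − X₀ | (1−t)X₀ + tX₁ = z]. Then the pair (α_t, v_t) satisfies the continuity equation in the weak sense: for every φ ∈ C_c^∞(ℝ^d) and every 0 < s ≤ u < 1, ∫ φ dα_u − ∫ φ dα_s = ∫_s^u ∫ ⟨∇φ(x), v_t(x)⟩ dα_t(x) dt. -/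
open MeasureTheory ProbabilityTheory
open scoped ENNReal

section

variable {Ω E : Type*} [MeasurableSpace Ω] {μ : Measure Ω} [NormedAddCommGroup E]

/-- A random vector whose law has a finite second moment is integrable. -/
theorem integrable_of_integrable_norm_sq_map [MeasurableSpace E] [BorelSpace E]
    [SecondCountableTopology E] [IsFiniteMeasure μ] {X : Ω → E} (hX : Measurable X)
    (h : Integrable (fun x => ‖x‖ ^ 2) (μ.map X)) : Integrable X μ := by
  have h2 : Integrable (fun ω => ‖X ω‖ ^ 2) μ := h.comp_measurable hX
  exact ((memLp_two_iff_integrable_sq_norm hX.aestronglyMeasurable).2 h2).integrable one_le_two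

variable [NormedSpace ℝ E]

/-- A bounded continuous field of functionals, evaluated on an integrable random vector, is
integrable. -/
theorem integrable_clm_comp_apply_of_bound {L : E → E →L[ℝ] ℝ} (hL : Continuous L) {C : ℝ}
    (hC : ∀ x, ‖L x‖ ≤ C) {Z Y : Ω → E} (hZ : AEStronglyMeasurable Z μ) (hY : Integrable Y μ) :
    Integrable (fun ω => L (Z ω) (Y ω)) μ := by
  refine (hY.norm.const_mul C).mono'
    ((ContinuousLinearMap.id ℝ (E →L[ℝ] ℝ)).aestronglyMeasurable_comp₂
      (hL.comp_aestronglyMeasurable hZ) hY.aestronglyMeasurable) (ae_of_all _ fun ω => ?_)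
  exact (L (Z ω)).le_of_opNorm_le (hC _) _

/-- Fundamental theorem of calculus, in expectation, along the linear interpolation of two
integrable random vectors. -/
theorem integral_comp_lerp_sub_eq_intervalIntegral [IsFiniteMeasure μ] {X₀ X₁ : Ω → E}
    (hX₀ : Integrable X₀ μ) (hX₁ : Integrable X₁ μ) {φ : E → ℝ} (hφ : ContDiff ℝ 1 φ)
    (hc : HasCompactSupport φ) (s u : ℝ) :
    (∫ ω, φ ((1 - u) • X₀ ω + u • X₁ ω) ∂μ) - (∫ ω, φ ((1 - s) • X₀ ω + s • X₁ ω) ∂μ) =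
      ∫ t in s..u, ∫ ω, fderiv ℝ φ ((1 - t) • X₀ ω + t • X₁ ω) (X₁ ω - X₀ ω) ∂μ := by
  have hcont : Continuous (fderiv ℝ φ) := hφ.continuous_fderiv one_ne_zero
  obtain ⟨C, hC⟩ := (hc.fderiv ℝ).exists_bound_of_continuous hcont
  obtain ⟨K, hK⟩ := hc.exists_bound_of_continuous hφ.continuous
  have hY : Integrable (fun ω => X₁ ω - X₀ ω) μ := hX₁.sub hX₀
  have hZ : ∀ t : ℝ, AEStronglyMeasurable (fun ω => (1 - t) • X₀ ω + t • X₁ ω) μ := fun t =>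
    ((hX₀.smul (1 - t)).add (hX₁.smul t)).aestronglyMeasurable
  have hF_int : ∀ t : ℝ, Integrable (fun ω => φ ((1 - t) • X₀ ω + t • X₁ ω)) μ := fun t =>
    .of_bound (hφ.continuous.comp_aestronglyMeasurable (hZ t)) K (ae_of_all _ fun ω => hK _)
  have hF'_int : ∀ t : ℝ, Integrable
      (fun ω => fderiv ℝ φ ((1 - t) • X₀ ω + t • X₁ ω) (X₁ ω - X₀ ω)) μ := fun t =>
    integrable_clm_comp_apply_of_bound hcont hC (hZ t) hY
  have hbound : ∀ (t : ℝ) (ω : Ω),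
      ‖fderiv ℝ φ ((1 - t) • X₀ ω + t • X₁ ω) (X₁ ω - X₀ ω)‖ ≤ C * ‖X₁ ω - X₀ ω‖ := fun t ω =>
    ContinuousLinearMap.le_of_opNorm_le _ (hC _) _
  have hline : ∀ (t : ℝ) (ω : Ω),
      HasDerivAt (fun t : ℝ => (1 - t) • X₀ ω + t • X₁ ω) (X₁ ω - X₀ ω) t := fun t ω => by
    have h := (((hasDerivAt_id t).const_sub 1).smul_const (X₀ ω)).add
      ((hasDerivAt_id t).smul_const (X₁ ω))
    rw [neg_one_smul, one_smul, neg_add_eq_sub] at h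
    exact h
  have hderiv : ∀ t : ℝ, HasDerivAt (fun t => ∫ ω, φ ((1 - t) • X₀ ω + t • X₁ ω) ∂μ)
      (∫ ω, fderiv ℝ φ ((1 - t) • X₀ ω + t • X₁ ω) (X₁ ω - X₀ ω) ∂μ) t := fun t =>
    (hasDerivAt_integral_of_dominated_loc_of_deriv_le (s := Set.univ) Filter.univ_mem
      (.of_forall fun t => (hF_int t).aestronglyMeasurable) (hF_int t)
      (F' := fun t ω => fderiv ℝ φ ((1 - t) • X₀ ω + t • X₁ ω) (X₁ ω - X₀ ω))
      (hF'_int t).aestronglyMeasurable (ae_of_all _ fun ω t _ => hbound t ω)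
      (hY.norm.const_mul C)
      (ae_of_all _ fun ω t _ =>
        ((hφ.differentiable one_ne_zero _).hasFDerivAt.comp_hasDerivAt t (hline t ω)))).2
  have hcontderiv : Continuous fun t : ℝ =>
      ∫ ω, fderiv ℝ φ ((1 - t) • X₀ ω + t • X₁ ω) (X₁ ω - X₀ ω) ∂μ :=
    continuous_of_dominated (fun t => (hF'_int t).aestronglyMeasurable)
      (fun t => ae_of_all _ (hbound t)) (hY.norm.const_mul C)
      (ae_of_all _ fun ω => (hcont.comp (by fun_prop)).clm_apply continuous_const)
  exact (intervalIntegral.integral_eq_sub_of_hasDerivAt (fun t _ => hderiv t)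
    (hcontderiv.intervalIntegrable s u)).symm

/-- Testing a random vector `Y` against a bounded continuous field of functionals evaluated at
`Z` only sees the conditional expectation of `Y` given `Z`. -/
theorem integral_clm_comp_apply_eq_of_ae_eq_condExp [MeasurableSpace E] [BorelSpace E]
    [SecondCountableTopology E] [CompleteSpace E] [IsFiniteMeasure μ] {L : E → E →L[ℝ] ℝ}
    (hL : Continuous L) {C : ℝ} (hC : ∀ x, ‖L x‖ ≤ C) {Z Y : Ω → E} (hZ : Measurable Z)
    (hY : Integrable Y μ) {w : E → E} (hw : Measurable w)
    (hwY : (fun ω => w (Z ω)) =ᵐ[μ] μ[Y | MeasurableSpace.comap Z inferInstance]) :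
    ∫ ω, L (Z ω) (Y ω) ∂μ = ∫ x, L x (w x) ∂(μ.map Z) := by
  have hmeas : AEStronglyMeasurable (fun x => L x (w x)) (μ.map Z) :=
    (ContinuousLinearMap.id ℝ (E →L[ℝ] ℝ)).aestronglyMeasurable_comp₂
      hL.aestronglyMeasurable hw.aestronglyMeasurable
  have hLZ : StronglyMeasurable[MeasurableSpace.comap Z inferInstance] (fun ω => L (Z ω)) :=
    hL.comp_stronglyMeasurable (comap_measurable Z).stronglyMeasurable
  rw [integral_map hZ.aemeasurable hmeas, ← integral_condExp hZ.comap_le]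
  refine integral_congr_ae ?_
  have h := condExp_bilin_of_stronglyMeasurable_left (ContinuousLinearMap.id ℝ (E →L[ℝ] ℝ)) hLZ
    (integrable_clm_comp_apply_of_bound hL hC hZ.aestronglyMeasurable hY) hY
  filter_upwards [h, hwY] with ω h₁ h₂
  rw [h₂]
  exact h₁

end

/-- **Flow matching: the conditional expectation field solves the continuity equation.**
Let `α₀, α₁` be probability measures on `ℝ^d` with finite second moments, `X₀ ∼ α₀` and
`X₁ ∼ α₁` independent, and `α t` the law of `(1-t)X₀ + tX₁`.  If for each `t ∈ (0,1)` the
Borel map `v t` is a version of the conditional expectation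
`E[X₁ - X₀ | (1-t)X₀ + tX₁]`, then `(α t, v t)` satisfies the continuity equation in the
weak sense: for every test function `φ ∈ C_c^∞` and `0 < s ≤ u < 1`,
`∫ φ dα_u - ∫ φ dα_s = ∫_s^u ∫ ⟨∇φ(x), v t x⟩ dα_t(x) dt`. -/
theorem flow_matching_continuity_equation
    (d : ℕ) (α₀ α₁ : Measure (EuclideanSpace ℝ (Fin d)))
    [IsProbabilityMeasure α₀] [IsProbabilityMeasure α₁]
    (hm₀ : Integrable (fun x => ‖x‖ ^ 2) α₀) (hm₁ : Integrable (fun x => ‖x‖ ^ 2) α₁)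
    (Ω : Type*) [MeasureSpace Ω] (μ : Measure Ω) [IsProbabilityMeasure μ]
    (X₀ X₁ : Ω → EuclideanSpace ℝ (Fin d))
    (hX₀ : Measurable X₀) (hX₁ : Measurable X₁)
    (hlaw₀ : μ.map X₀ = α₀) (hlaw₁ : μ.map X₁ = α₁)
    (hindep : IndepFun X₀ X₁ μ)
    (α : ℝ → Measure (EuclideanSpace ℝ (Fin d)))
    (hα : ∀ t : ℝ, α t = μ.map (fun ω => (1 - t) • X₀ ω + t • X₁ ω))
    (v : ℝ → EuclideanSpace ℝ (Fin d) → EuclideanSpace ℝ (Fin d))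
    (hv_meas : ∀ t ∈ Set.Ioo (0 : ℝ) 1, Measurable (v t))
    (hv : ∀ t ∈ Set.Ioo (0 : ℝ) 1,
      (fun ω => v t ((1 - t) • X₀ ω + t • X₁ ω)) =ᵐ[μ]
        μ[(fun ω => X₁ ω - X₀ ω) |
          MeasurableSpace.comap (fun ω => (1 - t) • X₀ ω + t • X₁ ω) inferInstance]) :
    ∀ φ : EuclideanSpace ℝ (Fin d) → ℝ, ContDiff ℝ (⊤ : ℕ∞) φ → HasCompactSupport φ →
      ∀ s u : ℝ, 0 < s → s ≤ u → u < 1 →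
        (∫ x, φ x ∂(α u)) - (∫ x, φ x ∂(α s)) =
          ∫ t in s..u, ∫ x, fderiv ℝ φ x (v t x) ∂(α t) := by
  intro φ hφ hc s u hs hsu hu
  have hφ₁ : ContDiff ℝ 1 φ := hφ.of_le (by exact_mod_cast le_top)
  have hcont : Continuous (fderiv ℝ φ) := hφ₁.continuous_fderiv one_ne_zero
  obtain ⟨C, hC⟩ := (hc.fderiv ℝ).exists_bound_of_continuous hcont
  have hI₀ : Integrable X₀ μ := integrable_of_integrable_norm_sq_map hX₀ (hlaw₀ ▸ hm₀)
  have hI₁ : Integrable X₁ μ := integrable_of_integrable_norm_sq_map hX₁ (hlaw₁ ▸ hm₁)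
  have hZ : ∀ t : ℝ, Measurable fun ω => (1 - t) • X₀ ω + t • X₁ ω := fun t =>
    (hX₀.const_smul (1 - t)).add (hX₁.const_smul t)
  have hφα : ∀ t, ∫ x, φ x ∂(α t) = ∫ ω, φ ((1 - t) • X₀ ω + t • X₁ ω) ∂μ := fun t => by
    rw [hα, integral_map (hZ t).aemeasurable hφ.continuous.aestronglyMeasurable]
  rw [hφα, hφα, integral_comp_lerp_sub_eq_intervalIntegral hI₀ hI₁ hφ₁ hc]
  refine intervalIntegral.integral_congr fun t ht => ?_
  rw [Set.uIcc_of_le hsu] at ht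
  have ht' : t ∈ Set.Ioo (0 : ℝ) 1 := ⟨hs.trans_le ht.1, ht.2.trans_lt hu⟩
  simp only [hα]
  exact integral_clm_comp_apply_eq_of_ae_eq_condExp hcont hC (hZ t) (hI₁.sub hI₀)
    (hv_meas t ht') (hv t ht')
end

section
/- Let α₁ be a probability measure on ℝ^d with finite second moment, let X₁ ∼ α₁ and Z ∼ N(0, Id_d) be independent, and for t ∈ (0,1) let Y_t := (1−t)X₁ + tZ. Then Y_t has a smooth, everywhere positive density ρ_t with respect to Lebesgue measure, and for (law of Y_t)-almost every y ∈ ℝ^d, E[X₁ − Z | Y_t = y] = y/(1−t) + (t/(1−t)) ∇ log ρ_t(y). In particular, the flow-matching velocity field at time t is the gradient field of the potential ψ_t(y) = ‖y‖²/(2(1−t)) + (t/(1−t)) log ρ_t(y). -/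
open MeasureTheory ProbabilityTheory
open scoped ENNReal

/-- The standard Gaussian measure `N(0, Id)` on `ℝ^d`. -/
noncomputable def stdGaussian (d : ℕ) : Measure (EuclideanSpace ℝ (Fin d)) :=
  (Measure.pi fun _ : Fin d => gaussianReal 0 1).map (EuclideanSpace.equiv (Fin d) ℝ).symm

/-- Every iterated derivative of an isotropic Gaussian is bounded. -/
theorem iteratedFDeriv_gaussian_bounded {E : Type*} [NormedAddCommGroup E] [InnerProductSpace ℝ E]
    {b : ℝ} (hb : 0 < b) (n : ℕ) :
    ∃ C, ∀ w : E, ‖iteratedFDeriv ℝ n (fun w : E => Real.exp (-b * ‖w‖ ^ 2)) w‖ ≤ C := by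
  have hq : Function.HasTemperateGrowth (fun w : E => -b * ‖w‖ ^ 2) :=
    (Function.HasTemperateGrowth.const (-b)).mul (Function.hasTemperateGrowth_norm_sq (H := E))
  obtain ⟨k, C, hC, hbound⟩ := hq.norm_iteratedFDeriv_le_uniform n
  refine ⟨n.factorial * (C + 1) ^ n * ((k * n).factorial * Real.exp (1 + 1 / (4 * b))), fun w => ?_⟩
  have hD1 : 1 ≤ (C + 1) * (1 + ‖w‖) ^ k := one_le_mul_of_one_le_of_one_le (by linarith)
    (one_le_pow₀ (by linarith [norm_nonneg w]))
  have h := norm_iteratedFDeriv_comp_le (n := n) (N := (⊤ : ℕ∞)) Real.contDiff_exp hq.1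
    (by exact_mod_cast le_top) w (C := Real.exp (-b * ‖w‖ ^ 2)) (D := (C + 1) * (1 + ‖w‖) ^ k)
    (fun i _ => by
      rw [norm_iteratedFDeriv_eq_norm_iteratedDeriv, iteratedDeriv_eq_iterate, Real.iter_deriv_exp,
        Real.norm_eq_abs, Real.abs_exp])
    (fun i hi hin => calc
      _ ≤ C * (1 + ‖w‖) ^ k := hbound i hin w
      _ ≤ (C + 1) * (1 + ‖w‖) ^ k := by gcongr; linarith
      _ ≤ _ := le_self_pow₀ hD1 (by omega))
  refine h.trans ?_
  have h1 : (1 + ‖w‖) ^ (k * n) ≤ (k * n).factorial * Real.exp (1 + ‖w‖) := by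
    have := Real.pow_div_factorial_le_exp (1 + ‖w‖) (by positivity) (k * n)
    rwa [div_le_iff₀' (by positivity)] at this
  have h2 : Real.exp (1 + ‖w‖) * Real.exp (-b * ‖w‖ ^ 2) ≤ Real.exp (1 + 1 / (4 * b)) := by
    rw [← Real.exp_add, Real.exp_le_exp]
    have : 1 / (4 * b) - ‖w‖ + b * ‖w‖ ^ 2 = b * (‖w‖ - 1 / (2 * b)) ^ 2 := by
      field_simp; ring
    nlinarith [mul_nonneg hb.le (sq_nonneg (‖w‖ - 1 / (2 * b)))]
  calc n.factorial * Real.exp (-b * ‖w‖ ^ 2) * ((C + 1) * (1 + ‖w‖) ^ k) ^ n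
      = n.factorial * (C + 1) ^ n * ((1 + ‖w‖) ^ (k * n) * Real.exp (-b * ‖w‖ ^ 2)) := by
        rw [mul_pow, ← pow_mul]; ring
    _ ≤ n.factorial * (C + 1) ^ n *
        ((k * n).factorial * Real.exp (1 + ‖w‖) * Real.exp (-b * ‖w‖ ^ 2)) := by gcongr
    _ ≤ _ := by
        rw [mul_assoc ((k * n).factorial : ℝ)]
        gcongr

section ParametricIntegral

variable {E : Type} [NormedAddCommGroup E] [NormedSpace ℝ E] [MeasurableSpace E] [BorelSpace E]
  [SecondCountableTopology E]

theorem hasFDerivAt_integral_comp_sub_smul {F : Type} [NormedAddCommGroup F] [NormedSpace ℝ F]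
    (ν : Measure E) [IsFiniteMeasure ν] (s : ℝ) {f : E → F} (hf : ContDiff ℝ 1 f)
    {C₀ C₁ : ℝ} (h₀ : ∀ w, ‖f w‖ ≤ C₀) (h₁ : ∀ w, ‖fderiv ℝ f w‖ ≤ C₁) (y : E) :
    HasFDerivAt (fun y => ∫ x, f (y - s • x) ∂ν) (∫ x, fderiv ℝ f (y - s • x) ∂ν) y := by
  have hf' : Continuous (fderiv ℝ f) := hf.continuous_fderiv one_ne_zero
  have hfc := hf.continuous
  refine hasFDerivAt_integral_of_dominated_of_fderiv_le (s := Set.univ) (bound := fun _ => C₁)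
    (F' := fun y x => fderiv ℝ f (y - s • x)) Filter.univ_mem
    (.of_forall fun y => ?_) ?_ ?_ (.of_forall fun x y _ => h₁ _) (integrable_const _)
    (.of_forall fun x y _ => ?_)
  · exact Continuous.aestronglyMeasurable (by fun_prop)
  · exact Integrable.of_bound (Continuous.aestronglyMeasurable (by fun_prop)) C₀
      (.of_forall fun x => h₀ _)
  · exact Continuous.aestronglyMeasurable (by fun_prop)
  · simpa [Function.comp_def] using ((hf.differentiable one_ne_zero _).hasFDerivAt (𝕜 := ℝ)).comp y
      ((hasFDerivAt_id y).sub_const (s • x))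

theorem contDiff_integral_comp_sub_smul {F : Type} [NormedAddCommGroup F] [NormedSpace ℝ F]
    (ν : Measure E) [IsFiniteMeasure ν] (s : ℝ) {f : E → F} (hf : ContDiff ℝ (⊤ : ℕ∞) f)
    (hbound : ∀ n : ℕ, ∃ C, ∀ w, ‖iteratedFDeriv ℝ n f w‖ ≤ C) :
    ContDiff ℝ (⊤ : ℕ∞) (fun y => ∫ x, f (y - s • x) ∂ν) := by
  rw [contDiff_infty]
  intro n
  have hderiv {F : Type} [NormedAddCommGroup F] [NormedSpace ℝ F] {f : E → F}
      (hf : ContDiff ℝ (⊤ : ℕ∞) f) (hbound : ∀ n : ℕ, ∃ C, ∀ w, ‖iteratedFDeriv ℝ n f w‖ ≤ C)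
      (y : E) :
      HasFDerivAt (fun y => ∫ x, f (y - s • x) ∂ν) (∫ x, fderiv ℝ f (y - s • x) ∂ν) y := by
    obtain ⟨C₀, h₀⟩ := hbound 0
    obtain ⟨C₁, h₁⟩ := hbound 1
    exact hasFDerivAt_integral_comp_sub_smul ν s (hf.of_le (by exact_mod_cast le_top))
      (fun w => by simpa using h₀ w) (fun w => by simpa [norm_iteratedFDeriv_one] using h₁ w) y
  induction n generalizing F with
  | zero =>
    exact contDiff_zero.2 (continuous_iff_continuousAt.2 fun y => (hderiv hf hbound y).continuousAt)
  | succ n ih =>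
    refine contDiff_succ_iff_hasFDerivAt.2 ⟨_, ?_, hderiv hf hbound⟩
    refine ih (hf.fderiv_right (by simp)) fun n => ?_
    obtain ⟨C, hC⟩ := hbound (n + 1)
    exact ⟨C, fun w => by rw [norm_iteratedFDeriv_fderiv]; exact hC w⟩

end ParametricIntegral
theorem map_withDensity_comp {α β : Type*} [MeasurableSpace α] [MeasurableSpace β]
    (κ : Measure α) {T : α → β} (hT : Measurable T) {f : β → ℝ≥0∞} (hf : Measurable f) :
    (κ.withDensity (f ∘ T)).map T = (κ.map T).withDensity f := by
  ext A hA
  rw [Measure.map_apply hT hA, withDensity_apply _ (hT hA), withDensity_apply _ hA,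
    setLIntegral_map hA hf hT]
  rfl

theorem pi_withDensity_ofReal {ι : Type*} [Fintype ι] {f : ℝ → ℝ} (hf : Integrable f)
    (hf₀ : ∀ x, 0 ≤ f x) [SigmaFinite (volume.withDensity fun x => ENNReal.ofReal (f x))] :
    (Measure.pi fun _ : ι => volume.withDensity fun x => ENNReal.ofReal (f x)) =
      volume.withDensity fun x : ι → ℝ => ENNReal.ofReal (∏ i, f (x i)) := by
  refine Measure.pi_eq fun s hs => ?_
  rw [withDensity_apply _ (MeasurableSet.univ_pi hs), volume_pi, Measure.restrict_pi_pi,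
    ← ofReal_integral_eq_lintegral_ofReal (Integrable.fintype_prod fun i => hf.restrict)
      (.of_forall fun x => Finset.prod_nonneg fun i _ => hf₀ _),
    integral_fintype_prod_eq_prod (fun _ => f),
    ENNReal.ofReal_prod_of_nonneg fun i _ => integral_nonneg hf₀]
  refine Finset.prod_congr rfl fun i _ => ?_
  rw [withDensity_apply _ (hs i), ofReal_integral_eq_lintegral_ofReal hf.restrict
    (.of_forall hf₀)]

theorem stdGaussian_eq_withDensity (d : ℕ) :
    ∃ K : ℝ, 0 < K ∧ stdGaussian d =
      volume.withDensity fun z => ENNReal.ofReal (K * Real.exp (-(1 / 2) * ‖z‖ ^ 2)) := by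
  refine ⟨(√(2 * Real.pi))⁻¹ ^ d, by positivity, ?_⟩
  have h : gaussianReal 0 1 = volume.withDensity fun x => ENNReal.ofReal (gaussianPDFReal 0 1 x) :=
    gaussianReal_of_var_ne_zero 0 one_ne_zero
  have : SigmaFinite (volume.withDensity fun x => ENNReal.ofReal (gaussianPDFReal 0 1 x)) := by
    rw [← h]; infer_instance
  have hmp := PiLp.volume_preserving_toLp (Fin d)
  unfold _root_.stdGaussian
  simp only [h]
  rw [pi_withDensity_ofReal (integrable_gaussianPDFReal 0 1) (gaussianPDFReal_nonneg 0 1),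
    ← hmp.map_eq]
  rw [← map_withDensity_comp _ hmp.measurable (by fun_prop)]
  congr 2
  ext x
  have hexp : ∑ i, -x i ^ 2 / 2 = -(1 / 2) * ∑ i, x i ^ 2 := by
    rw [Finset.mul_sum]
    exact Finset.sum_congr rfl fun i _ => by ring
  simp [gaussianPDFReal, Finset.prod_mul_distrib, ← Real.exp_sum, EuclideanSpace.norm_sq_eq, hexp]

section Shear

variable {E : Type*} [NormedAddCommGroup E] [NormedSpace ℝ E] [MeasurableSpace E] [BorelSpace E]
  [FiniteDimensional ℝ E]

/-- Joint law of `(x, s x + t z)` when `x ∼ α` and `z` has density `g`, independently. -/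
theorem map_prod_withDensity_shear (α vol : Measure E) [IsProbabilityMeasure α]
    [vol.IsAddHaarMeasure] {g : E → ℝ≥0∞} (hg : Measurable g) [SFinite (vol.withDensity g)]
    (s : ℝ) {t : ℝ} (ht : t ≠ 0) :
    (α.prod (vol.withDensity g)).map (fun p => (p.1, s • p.1 + t • p.2)) =
      (α.prod vol).withDensity fun p =>
        ENNReal.ofReal |(t ^ Module.finrank ℝ E)⁻¹| * g (t⁻¹ • (p.2 - s • p.1)) := by
  set c := ENNReal.ofReal |(t ^ Module.finrank ℝ E)⁻¹| with hc
  have hT : MeasurePreserving (fun p : E × E => (p.1, s • p.1 + t • p.2)) (α.prod vol)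
      (α.prod (c • vol)) := by
    refine (MeasurePreserving.id α).skew_product (g := fun x z => s • x + t • z)
      (by fun_prop) (.of_forall fun x => ?_)
    have : (fun z : E => s • x + t • z) = (fun z => s • x + z) ∘ (t • ·) := rfl
    rw [this, ← Measure.map_map (by fun_prop) (by fun_prop), Measure.map_addHaar_smul _ ht,
      Measure.map_smul, map_add_left_eq_self]
  have hf : Measurable fun p : E × E => g (t⁻¹ • (p.2 - s • p.1)) := by fun_prop
  rw [prod_withDensity_right hg]
  have : (fun p : E × E => g p.2) = (fun p : E × E => g (t⁻¹ • (p.2 - s • p.1))) ∘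
      (fun p : E × E => (p.1, s • p.1 + t • p.2)) := by
    ext p; simp [smul_smul, ht]
  rw [this, map_withDensity_comp _ hT.measurable hf, hT.map_eq, Measure.prod_smul_right,
    withDensity_smul_measure, ← withDensity_smul _ hf]
  rfl

end Shear

/-- Bayes' formula: conditional expectation given `Y` from a joint density of `(X, Y)`. -/
theorem condExp_eq_of_joint_density {Ω E F : Type*} {mΩ : MeasurableSpace Ω} [MeasurableSpace E]
    [MeasurableSpace F] {G : Type*} [NormedAddCommGroup G] [NormedSpace ℝ G] [CompleteSpace G]
    (μ : Measure Ω) [IsProbabilityMeasure μ] {X : Ω → E} {Y : Ω → F} (hX : Measurable X)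
    (hY : Measurable Y) (α : Measure E) (β : Measure F) [SFinite α] [SFinite β]
    {κ : E × F → ℝ} (hκ : Measurable κ) (hκ₀ : ∀ p, 0 ≤ κ p)
    (hjoint : μ.map (fun ω => (X ω, Y ω)) = (α.prod β).withDensity fun p => ENNReal.ofReal (κ p))
    {ρ : F → ℝ} (hρ : Measurable ρ) (hρ₀ : ∀ y, 0 ≤ ρ y)
    (hmarg : μ.map Y = β.withDensity fun y => ENNReal.ofReal (ρ y))
    {f : E × F → G} (hf : StronglyMeasurable f) (hfint : Integrable (fun ω => f (X ω, Y ω)) μ)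
    {m : F → G} (hm : StronglyMeasurable m)
    (hmρ : ∀ y, ρ y • m y = ∫ x, κ (x, y) • f (x, y) ∂α) :
    (fun ω => m (Y ω)) =ᵐ[μ]
      μ[fun ω => f (X ω, Y ω) | MeasurableSpace.comap Y inferInstance] := by
  have hXY : Measurable fun ω => (X ω, Y ω) := hX.prodMk hY
  have hκf : Integrable (fun p => κ p • f p) (α.prod β) := by
    have h := (integrable_map_measure hf.aestronglyMeasurable hXY.aemeasurable).2 hfint
    rw [hjoint, integrable_withDensity_iff_integrable_smul' (by fun_prop) (by simp)] at h
    simpa [ENNReal.toReal_ofReal, hκ₀] using h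
  have hmint : Integrable (fun ω => m (Y ω)) μ := by
    refine (integrable_map_measure hm.aestronglyMeasurable hY.aemeasurable).1 ?_
    rw [hmarg, integrable_withDensity_iff_integrable_smul' (by fun_prop) (by simp)]
    simpa [ENNReal.toReal_ofReal, hρ₀, hmρ] using hκf.integral_prod_right
  refine ae_eq_condExp_of_forall_setIntegral_eq hY.comap_le hfint
    (fun A _ _ => hmint.integrableOn) ?_
    (hm.comp_measurable (comap_measurable Y)).aestronglyMeasurable
  rintro _ ⟨B, hB, rfl⟩ -
  have hl : ∫ ω in Y ⁻¹' B, m (Y ω) ∂μ = ∫ y in B, ρ y • m y ∂β := by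
    rw [← setIntegral_map hB hm.aestronglyMeasurable hY.aemeasurable, hmarg,
      setIntegral_withDensity_eq_setIntegral_toReal_smul (by fun_prop) (by simp) _ hB]
    simp [ENNReal.toReal_ofReal, hρ₀]
  have hr : ∫ ω in Y ⁻¹' B, f (X ω, Y ω) ∂μ =
      ∫ p in Set.univ ×ˢ B, κ p • f p ∂(α.prod β) := by
    have hB' : MeasurableSet ((Set.univ : Set E) ×ˢ B) := MeasurableSet.univ.prod hB
    have : Y ⁻¹' B = (fun ω => (X ω, Y ω)) ⁻¹' (Set.univ ×ˢ B) := by ext; simp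
    rw [this, ← setIntegral_map hB' hf.aestronglyMeasurable hXY.aemeasurable, hjoint,
      setIntegral_withDensity_eq_setIntegral_toReal_smul (by fun_prop) (by simp) _ hB']
    simp [ENNReal.toReal_ofReal, hκ₀]
  rw [hl, hr, ← Measure.prod_restrict, Measure.restrict_univ, integral_prod_symm]
  · simp [hmρ]
  · have := hκf.integrableOn (s := Set.univ ×ˢ B)
    rwa [IntegrableOn, ← Measure.prod_restrict, Measure.restrict_univ] at this

theorem map_snd_withDensity_prod {E F : Type*} [MeasurableSpace E] [MeasurableSpace F]
    (α : Measure E) (β : Measure F) [SFinite α] [SFinite β] {κ : E × F → ℝ} (hκ : Measurable κ)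
    (hκ₀ : ∀ p, 0 ≤ κ p) (hint : ∀ y, Integrable (fun x => κ (x, y)) α) :
    ((α.prod β).withDensity fun p => ENNReal.ofReal (κ p)).map Prod.snd =
      β.withDensity fun y => ENNReal.ofReal (∫ x, κ (x, y) ∂α) := by
  ext B hB
  rw [Measure.map_apply measurable_snd hB, withDensity_apply _ (measurable_snd hB),
    withDensity_apply _ hB, ← Set.univ_prod, ← Measure.prod_restrict, Measure.restrict_univ,
    lintegral_prod_symm _ (by fun_prop)]
  exact lintegral_congr fun y =>
    (ofReal_integral_eq_lintegral_ofReal (hint y) (.of_forall fun x => hκ₀ _)).symm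

section GaussianMixture

variable {E : Type} [NormedAddCommGroup E] [InnerProductSpace ℝ E]

theorem contDiff_gaussian (A b : ℝ) :
    ContDiff ℝ (⊤ : ℕ∞) fun w : E => A * Real.exp (-b * ‖w‖ ^ 2) :=
  contDiff_const.mul (contDiff_const.mul (contDiff_norm_sq ℝ)).exp

theorem iteratedFDeriv_const_mul_gaussian_bounded (A : ℝ) {b : ℝ} (hb : 0 < b) (n : ℕ) :
    ∃ C, ∀ w : E, ‖iteratedFDeriv ℝ n (fun w : E => A * Real.exp (-b * ‖w‖ ^ 2)) w‖ ≤ C := by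
  obtain ⟨C, hC⟩ := iteratedFDeriv_gaussian_bounded (E := E) hb n
  refine ⟨‖A‖ * C, fun w => ?_⟩
  have h1 : ContDiffAt ℝ n (fun w : E => Real.exp (-b * ‖w‖ ^ 2)) w := by
    simpa using ((contDiff_gaussian 1 b).of_le (by exact_mod_cast le_top)).contDiffAt
  have := iteratedFDeriv_const_smul_apply (a := A) h1
  simp only [Pi.smul_def, smul_eq_mul] at this
  rw [this, norm_smul]
  gcongr
  exact hC w

theorem integrable_gaussian_comp [MeasurableSpace E] [BorelSpace E]
    (α : Measure E) [IsFiniteMeasure α] (A s : ℝ) {b : ℝ} (hb : 0 < b) (y : E) :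
    Integrable (fun x => A * Real.exp (-b * ‖y - s • x‖ ^ 2)) α := by
  obtain ⟨C, hC⟩ := iteratedFDeriv_const_mul_gaussian_bounded (E := E) A hb 0
  exact Integrable.of_bound (Continuous.aestronglyMeasurable (by fun_prop)) C
    (.of_forall fun x => by simpa using hC (y - s • x))

theorem gaussian_mixture_pos [MeasurableSpace E] [BorelSpace E] (α : Measure E)
    [IsProbabilityMeasure α] {A : ℝ} (hA : 0 < A) (s : ℝ) {b : ℝ} (hb : 0 < b) (y : E) :
    0 < ∫ x, A * Real.exp (-b * ‖y - s • x‖ ^ 2) ∂α := by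
  rw [integral_pos_iff_support_of_nonneg (fun x => by positivity)
    (integrable_gaussian_comp α A s hb y)]
  have : (Function.support fun x => A * Real.exp (-b * ‖y - s • x‖ ^ 2)) = Set.univ := by
    ext x; simp [hA.ne']
  rw [this, measure_univ]
  exact one_pos

theorem contDiff_gaussian_mixture [MeasurableSpace E] [BorelSpace E]
    [SecondCountableTopology E] (α : Measure E) [IsFiniteMeasure α] (A s : ℝ) {b : ℝ} (hb : 0 < b) :
    ContDiff ℝ (⊤ : ℕ∞) fun y => ∫ x, A * Real.exp (-b * ‖y - s • x‖ ^ 2) ∂α :=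
  contDiff_integral_comp_sub_smul α s (contDiff_gaussian (E := E) A b)
    (iteratedFDeriv_const_mul_gaussian_bounded A hb)

variable [CompleteSpace E]

theorem hasGradientAt_gaussian (A b : ℝ) (w : E) :
    HasGradientAt (fun w : E => A * Real.exp (-b * ‖w‖ ^ 2))
      ((-(2 * b)) • (A * Real.exp (-b * ‖w‖ ^ 2)) • w) w := by
  rw [hasGradientAt_iff_hasFDerivAt]
  refine ((((hasStrictFDerivAt_norm_sq w).hasFDerivAt.const_mul (-b)).exp).const_mul A).congr_fderiv
    ?_
  ext v
  simp
  ring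

theorem hasGradientAt_log {f : E → ℝ} {f' x : E} (hf : HasGradientAt f f' x) (hx : f x ≠ 0) :
    HasGradientAt (fun x => Real.log (f x)) ((f x)⁻¹ • f') x := by
  rw [hasGradientAt_iff_hasFDerivAt] at hf ⊢
  simpa using hf.log hx

theorem hasGradientAt_potential {f : E → ℝ} {f' x : E} (hf : HasGradientAt f f' x) (a c : ℝ) :
    HasGradientAt (fun x => ‖x‖ ^ 2 / (2 * a) + c * f x) ((1 / a) • x + c • f') x := by
  rw [hasGradientAt_iff_hasFDerivAt] at hf ⊢
  have h := ((hasStrictFDerivAt_norm_sq x).hasFDerivAt.mul_const (2 * a)⁻¹).add (hf.const_mul c)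
  simp only [← div_eq_mul_inv] at h
  refine h.congr_fderiv ?_
  ext v
  simp
  ring

variable [MeasurableSpace E] [BorelSpace E] [SecondCountableTopology E]

theorem integrable_gaussian_smul_comp (α : Measure E) [IsFiniteMeasure α] (A s : ℝ) {b : ℝ}
    (hb : 0 < b) (y : E) :
    Integrable (fun x => (A * Real.exp (-b * ‖y - s • x‖ ^ 2)) • (y - s • x)) α := by
  obtain ⟨C, hC⟩ := iteratedFDeriv_const_mul_gaussian_bounded (E := E) A hb 1
  refine Integrable.of_bound (Continuous.aestronglyMeasurable (by fun_prop)) ((2 * b)⁻¹ * C)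
    (.of_forall fun x => ?_)
  have h := hC (y - s • x)
  rw [norm_iteratedFDeriv_one, (hasGradientAt_gaussian A b (y - s • x)).hasFDerivAt.fderiv,
    LinearIsometryEquiv.norm_map, norm_smul, norm_neg, Real.norm_of_nonneg (by positivity)] at h
  rwa [inv_mul_eq_div, le_div_iff₀' (by positivity)]

theorem hasGradientAt_gaussian_mixture (α : Measure E) [IsFiniteMeasure α] (A s : ℝ) {b : ℝ}
    (hb : 0 < b) (y : E) :
    HasGradientAt (fun y => ∫ x, A * Real.exp (-b * ‖y - s • x‖ ^ 2) ∂α)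
      ((-(2 * b)) • ∫ x, (A * Real.exp (-b * ‖y - s • x‖ ^ 2)) • (y - s • x) ∂α) y := by
  obtain ⟨C₀, h₀⟩ := iteratedFDeriv_const_mul_gaussian_bounded (E := E) A hb 0
  obtain ⟨C₁, h₁⟩ := iteratedFDeriv_const_mul_gaussian_bounded (E := E) A hb 1
  have h := hasFDerivAt_integral_comp_sub_smul α s
    ((contDiff_gaussian (E := E) A b).of_le (by exact_mod_cast le_top))
    (fun w => by simpa using h₀ w) (fun w => by simpa [norm_iteratedFDeriv_one] using h₁ w) y
  rw [hasGradientAt_iff_hasFDerivAt]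
  refine h.congr_fderiv ?_
  rw [← integral_smul]
  exact (integral_congr_ae (.of_forall fun x =>
    (hasGradientAt_gaussian A b (y - s • x)).hasFDerivAt.fderiv)).trans
    ((InnerProductSpace.toDual ℝ E).toContinuousLinearEquiv.integral_comp_comm _)

theorem integral_gaussian_smul_sub (α : Measure E) [IsFiniteMeasure α] (A : ℝ) {b : ℝ}
    (hb : 0 < b) {t : ℝ} (ht : t ∈ Set.Ioo (0 : ℝ) 1) (y : E) :
    ∫ x, (A * Real.exp (-b * ‖y - (1 - t) • x‖ ^ 2)) • t⁻¹ • (x - y) ∂α =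
      (1 / (1 - t)) • (∫ x, A * Real.exp (-b * ‖y - (1 - t) • x‖ ^ 2) ∂α) • y -
        (1 / ((1 - t) * t)) •
          ∫ x, (A * Real.exp (-b * ‖y - (1 - t) • x‖ ^ 2)) • (y - (1 - t) • x) ∂α := by
  have ht0 : t ≠ 0 := ht.1.ne'
  have hs0 : 1 - t ≠ 0 := by linarith [ht.2]
  rw [← integral_smul_const, ← integral_smul, ← integral_smul]
  refine Eq.trans ?_ (integral_sub
    (((integrable_gaussian_comp α A _ hb y).smul_const y).smul (1 / (1 - t)))
    ((integrable_gaussian_smul_comp α A _ hb y).smul (1 / ((1 - t) * t))))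
  refine integral_congr_ae (.of_forall fun x => ?_)
  change _ = _ • _ • y - _ • _ • (y - _)
  match_scalars <;> field_simp
  all_goals ring

end GaussianMixture

theorem integrable_id_stdGaussian (d : ℕ) : Integrable (fun z => z) (stdGaussian d) := by
  have : stdGaussian d = ProbabilityTheory.stdGaussian (EuclideanSpace ℝ (Fin d)) :=
    map_pi_eq_stdGaussian
  rw [this]
  exact IsGaussian.integrable_id

/-- **Score form of the flow-matching field with a Gaussian latent (Tweedie).**
Let `α₁` have finite second moment, `X₁ ∼ α₁` and `Z ∼ N(0, Id_d)` independent, and for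
`t ∈ (0,1)` let `Y_t = (1-t)X₁ + tZ`.  Then `Y_t` has a smooth everywhere positive density
`ρ_t` with respect to Lebesgue measure and, for (law of `Y_t`)-almost every `y`, any Borel
version `v` of `E[X₁ - Z | Y_t = ·]` satisfies
`v y = y/(1-t) + (t/(1-t)) ∇ log ρ_t(y)`; in particular `v` is the gradient field of the
potential `ψ_t(y) = ‖y‖²/(2(1-t)) + (t/(1-t)) log ρ_t(y)`. -/
theorem flow_matching_score_field
    (d : ℕ) (α₁ : Measure (EuclideanSpace ℝ (Fin d))) [IsProbabilityMeasure α₁]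
    (hm₁ : Integrable (fun x => ‖x‖ ^ 2) α₁)
    (Ω : Type*) [MeasureSpace Ω] (μ : Measure Ω) [IsProbabilityMeasure μ]
    (X₁ Z : Ω → EuclideanSpace ℝ (Fin d))
    (hX₁ : Measurable X₁) (hZ : Measurable Z)
    (hlaw₁ : μ.map X₁ = α₁) (hlawZ : μ.map Z = stdGaussian d)
    (hindep : IndepFun Z X₁ μ)
    (t : ℝ) (ht : t ∈ Set.Ioo (0 : ℝ) 1)
    (Y : Ω → EuclideanSpace ℝ (Fin d))
    (hY : Y = fun ω => (1 - t) • X₁ ω + t • Z ω) :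
    ∃ ρ : EuclideanSpace ℝ (Fin d) → ℝ,
      (∀ y, 0 < ρ y) ∧ ContDiff ℝ (⊤ : ℕ∞) ρ ∧
      μ.map Y = volume.withDensity (fun y => ENNReal.ofReal (ρ y)) ∧
      ∀ v : EuclideanSpace ℝ (Fin d) → EuclideanSpace ℝ (Fin d), Measurable v →
        ((fun ω => v (Y ω)) =ᵐ[μ]
          μ[(fun ω => X₁ ω - Z ω) | MeasurableSpace.comap Y inferInstance]) →
        ∀ᵐ y ∂(μ.map Y),
          v y = (1 / (1 - t)) • y +
              (t / (1 - t)) • gradient (fun x => Real.log (ρ x)) y ∧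
          v y = gradient
              (fun x => ‖x‖ ^ 2 / (2 * (1 - t)) + (t / (1 - t)) * Real.log (ρ x)) y := by
  have ht0 : t ≠ 0 := ht.1.ne'
  obtain ⟨K, hK, hKd⟩ := stdGaussian_eq_withDensity d
  set A := |(t ^ Module.finrank ℝ (EuclideanSpace ℝ (Fin d)))⁻¹| * K with hAdef
  have hA : 0 < A := by positivity
  set b := 1 / 2 * (t⁻¹) ^ 2 with hbdef
  have hb : 0 < b := by have := ht.1; positivity
  set κ : EuclideanSpace ℝ (Fin d) × EuclideanSpace ℝ (Fin d) → ℝ :=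
    fun p => A * Real.exp (-b * ‖p.2 - (1 - t) • p.1‖ ^ 2) with hκdef
  have hκ : Measurable κ := by fun_prop
  have hκ₀ : ∀ p, 0 ≤ κ p := fun p => by positivity
  set ρ : EuclideanSpace ℝ (Fin d) → ℝ := fun y => ∫ x, κ (x, y) ∂α₁ with hρdef
  have hρpos : ∀ y, 0 < ρ y := gaussian_mixture_pos α₁ hA (1 - t) hb
  have hρsmooth : ContDiff ℝ (⊤ : ℕ∞) ρ := contDiff_gaussian_mixture α₁ A (1 - t) hb
  have hYm : Measurable Y := by rw [hY]; fun_prop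
  have hjoint : μ.map (fun ω => (X₁ ω, Y ω)) =
      (α₁.prod volume).withDensity fun p => ENNReal.ofReal (κ p) := by
    have hind := hindep.symm.map_prod_eq_prod_map_map hX₁.aemeasurable hZ.aemeasurable
    rw [hlaw₁, hlawZ, hKd] at hind
    have hcomp : (fun ω => (X₁ ω, Y ω)) = (fun p => (p.1, (1 - t) • p.1 + t • p.2)) ∘
        fun ω => (X₁ ω, Z ω) := by rw [hY]; rfl
    rw [hcomp, ← Measure.map_map (by fun_prop) (by fun_prop), hind,
      map_prod_withDensity_shear α₁ volume (by fun_prop) (1 - t) ht0]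
    congr with p
    rw [← ENNReal.ofReal_mul (abs_nonneg _), norm_smul, mul_pow, Real.norm_eq_abs, sq_abs]
    simp only [hκdef, hAdef, hbdef]
    ring_nf
  have hmarg : μ.map Y = volume.withDensity fun y => ENNReal.ofReal (ρ y) := by
    rw [← map_snd_withDensity_prod α₁ volume hκ hκ₀ (integrable_gaussian_comp α₁ A (1 - t) hb),
      ← hjoint, Measure.map_map measurable_snd (by fun_prop)]
    rfl
  refine ⟨ρ, hρpos, hρsmooth, hmarg, fun v hv hvY => ?_⟩
  have hgrad (y) := hasGradientAt_log (hasGradientAt_gaussian_mixture α₁ A (1 - t) hb y)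
    (hρpos y).ne'
  set m : EuclideanSpace ℝ (Fin d) → EuclideanSpace ℝ (Fin d) := fun y =>
    (ρ y)⁻¹ • ∫ x, κ (x, y) • t⁻¹ • (x - y) ∂α₁ with hmdef
  have hκfm : StronglyMeasurable fun p : EuclideanSpace ℝ (Fin d) × EuclideanSpace ℝ (Fin d) =>
      κ p • t⁻¹ • (p.1 - p.2) := Measurable.stronglyMeasurable (by fun_prop)
  have hm : StronglyMeasurable m :=
    (hρsmooth.continuous.measurable.inv.stronglyMeasurable).smul
      (hκfm.comp_measurable measurable_swap).integral_prod_right'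
  have hm_eq (y) : m y = (1 / (1 - t)) • y +
      (t / (1 - t)) • gradient (fun x => Real.log (ρ x)) y := by
    have hs0 : 1 - t ≠ 0 := by linarith [ht.2]
    have hρ0 : ρ y ≠ 0 := (hρpos y).ne'
    rw [(hgrad y).gradient]
    refine (congrArg ((ρ y)⁻¹ • ·) (integral_gaussian_smul_sub α₁ A hb ht y)).trans ?_
    change (ρ y)⁻¹ • ((1 / (1 - t)) • ρ y • y - _) = _ + _ • (ρ y)⁻¹ • _
    rw [show 2 * b = (t⁻¹) ^ 2 by simp only [hbdef]; ring]
    match_scalars <;> field_simp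
  have hXZ : (fun ω => X₁ ω - Z ω) = fun ω => t⁻¹ • (X₁ ω - Y ω) := by
    funext ω
    rw [hY]
    match_scalars <;> field_simp
    ring
  have hXint : Integrable X₁ μ := by
    have : MemLp (fun x => x) 2 α₁ :=
      (memLp_two_iff_integrable_sq_norm aestronglyMeasurable_id).2 hm₁
    rw [← hlaw₁] at this
    exact (integrable_map_measure aestronglyMeasurable_id hX₁.aemeasurable).1
      (this.integrable one_le_two)
  have hZint : Integrable Z μ := by
    have := integrable_id_stdGaussian d
    rw [← hlawZ] at this
    exact (integrable_map_measure aestronglyMeasurable_id hZ.aemeasurable).1 this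
  have hcond := condExp_eq_of_joint_density μ hX₁ hYm α₁ volume hκ hκ₀ hjoint
    hρsmooth.continuous.measurable (fun y => (hρpos y).le) hmarg
    (f := fun p => t⁻¹ • (p.1 - p.2)) (Measurable.stronglyMeasurable (by fun_prop))
    (by have := hXint.sub hZint; rwa [show X₁ - Z = _ from hXZ] at this) hm
    (fun y => smul_inv_smul₀ (hρpos y).ne' _)
  have hvm : ∀ᵐ y ∂(μ.map Y), v y = m y := by
    rw [ae_map_iff hYm.aemeasurable (measurableSet_eq_fun hv hm.measurable)]
    rw [hXZ] at hvY
    exact hvY.trans hcond.symm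
  filter_upwards [hvm] with y hy
  refine ⟨hy.trans (hm_eq y), ?_⟩
  rw [hy, hm_eq, (hasGradientAt_potential (hgrad y) (1 - t) (t / (1 - t))).gradient,
    (hgrad y).gradient]
end

section
/- (Benamou–Brenier) Let α₀ and α₁ be probability measures on ℝ^d with finite second moments. Then W₂²(α₀,α₁) equals the infimum, over all curves of probability measures (α_t)_{t∈[0,1]} with α_{t=0} = α₀ and α_{t=1} = α₁ and all Borel velocity fields v : [0,1]×ℝ^d → ℝ^d such that (α_t, v_t) satisfies the continuity equation in the weak sense, of the kinetic energy ∫₀¹ ∫ ‖v_t(x)‖² dα_t(x) dt. -/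
open MeasureTheory
open scoped ENNReal

/-- The Kantorovich quadratic optimal transport cost `W₂²(α₀, α₁)`: the infimum over all
couplings `π` of `α₀` and `α₁` of `∬ ‖x - y‖² dπ(x,y)`. -/
noncomputable def W2sq {d : ℕ} (α₀ α₁ : Measure (EuclideanSpace ℝ (Fin d))) : ℝ≥0∞ :=
  ⨅ (π : Measure (EuclideanSpace ℝ (Fin d) × EuclideanSpace ℝ (Fin d)))
    (_ : π.map Prod.fst = α₀) (_ : π.map Prod.snd = α₁),
    ∫⁻ p, ENNReal.ofReal (‖p.1 - p.2‖ ^ 2) ∂π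

/-- A curve of measures `(α t)` and a velocity field `(v t)` satisfy the continuity equation
`∂ₜ α + div(α v) = 0` on `[0,1]` in the weak sense: for every test function
`φ ∈ C_c^∞(ℝ^d)`, the map `t ↦ ∫ φ dα_t` is absolutely continuous with derivative
`∫ ⟨∇φ(x), v_t(x)⟩ dα_t(x)` for a.e. `t`, i.e. it is given by the integral of this
(locally integrable) derivative. -/
def SatisfiesContinuityEq {d : ℕ} (α : ℝ → Measure (EuclideanSpace ℝ (Fin d)))
    (v : ℝ → EuclideanSpace ℝ (Fin d) → EuclideanSpace ℝ (Fin d)) : Prop :=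
  ∀ φ : EuclideanSpace ℝ (Fin d) → ℝ, ContDiff ℝ (⊤ : ℕ∞) φ → HasCompactSupport φ →
    IntervalIntegrable (fun t => ∫ x, fderiv ℝ φ x (v t x) ∂(α t)) volume 0 1 ∧
    ∀ s u : ℝ, s ∈ Set.Icc (0 : ℝ) 1 → u ∈ Set.Icc (0 : ℝ) 1 →
      (∫ x, φ x ∂(α u)) - (∫ x, φ x ∂(α s)) =
        ∫ t in s..u, ∫ x, fderiv ℝ φ x (v t x) ∂(α t)

open Set Filter Topology

/-- The straight-line interpolation `(1 - t) x + t y`. -/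
def lineInterp {E : Type*} [AddCommGroup E] [Module ℝ E] (t : ℝ) (p : E × E) : E :=
  p.1 + t • (p.2 - p.1)

section Interpolation

variable {d : ℕ} (π : Measure (EuclideanSpace ℝ (Fin d) × EuclideanSpace ℝ (Fin d)))

lemma measurable_lineInterp_uncurry :
    Measurable (fun q : ℝ × (EuclideanSpace ℝ (Fin d) × EuclideanSpace ℝ (Fin d)) =>
      (q.1, lineInterp q.1 q.2)) := by
  unfold lineInterp
  fun_prop

lemma measurable_lineInterp (t : ℝ) :
    Measurable (lineInterp t :
      EuclideanSpace ℝ (Fin d) × EuclideanSpace ℝ (Fin d) → EuclideanSpace ℝ (Fin d)) := by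
  unfold lineInterp
  fun_prop

lemma integral_fderiv_lineInterp {E : Type*} [NormedAddCommGroup E] [NormedSpace ℝ E]
    {φ : E → ℝ} (hφ : ContDiff ℝ (⊤ : ℕ∞) φ) (p : E × E) (u : ℝ) :
    ∫ t in (0 : ℝ)..u, fderiv ℝ φ (lineInterp t p) (p.2 - p.1) =
      φ (lineInterp u p) - φ (lineInterp 0 p) := by
  have hd : ∀ t : ℝ, HasDerivAt (fun t => φ (lineInterp t p))
      (fderiv ℝ φ (lineInterp t p) (p.2 - p.1)) t := fun t => by
    have h1 : HasDerivAt (fun t => lineInterp t p) (p.2 - p.1) t := by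
      simpa [lineInterp] using ((hasDerivAt_id t).smul_const (p.2 - p.1)).const_add p.1
    exact (hφ.differentiable (by simp) _).hasFDerivAt.comp_hasDerivAt t h1
  refine intervalIntegral.integral_eq_sub_of_hasDerivAt (fun t _ => hd t) ?_
  have hc : Continuous (fun t => fderiv ℝ φ (lineInterp t p) (p.2 - p.1)) := by
    have := hφ.continuous_fderiv (by simp)
    unfold lineInterp
    fun_prop
  exact hc.intervalIntegrable _ _

/-- A Borel velocity field driving the displacement interpolation of a coupling. -/
lemma exists_velocity_lineInterp [IsProbabilityMeasure π]
    (hπ : ∫⁻ p, ENNReal.ofReal (‖p.1 - p.2‖ ^ 2) ∂π ≠ ⊤) :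
    ∃ v : ℝ → EuclideanSpace ℝ (Fin d) → EuclideanSpace ℝ (Fin d),
      Measurable (Function.uncurry v) ∧
      SatisfiesContinuityEq (fun t => π.map (lineInterp t)) v ∧
      ∫⁻ t in Icc (0 : ℝ) 1, ∫⁻ x, ENNReal.ofReal (‖v t x‖ ^ 2) ∂(π.map (lineInterp t)) ≤
        ∫⁻ p, ENNReal.ofReal (‖p.1 - p.2‖ ^ 2) ∂π := by
  set E := EuclideanSpace ℝ (Fin d)
  let T : ℝ × (E × E) → ℝ × E := fun q => (q.1, lineInterp q.1 q.2)
  have hT : Measurable T := measurable_lineInterp_uncurry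
  have : IsProbabilityMeasure (volume.restrict (Icc (0 : ℝ) 1)) := ⟨by simp⟩
  let P : Measure (ℝ × (E × E)) := (volume.restrict (Icc (0 : ℝ) 1)).prod π
  let F : ℝ × (E × E) → E := fun q => q.2.2 - q.2.1
  have hFm : Measurable F := by fun_prop
  have hm := hT.comap_le
  let m := MeasurableSpace.comap T inferInstance
  have hFe : eLpNorm F 2 P ^ 2 = ∫⁻ p, ENNReal.ofReal (‖p.1 - p.2‖ ^ 2) ∂π := by
    have : eLpNorm F 2 P ^ 2 = ∫⁻ q, ‖F q‖ₑ ^ 2 ∂P := by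
      have := eLpNorm_nnreal_pow_eq_lintegral (f := F) (μ := P) (p := 2) (by simp)
      simpa using this
    rw [this, lintegral_prod _ (by fun_prop)]
    simp only [lintegral_const, measure_univ, mul_one, F]
    refine lintegral_congr fun p => ?_
    rw [← ofReal_norm, ← ENNReal.ofReal_pow (norm_nonneg _), norm_sub_rev]
  have hF2 : MemLp F 2 P := by
    refine ⟨hFm.aestronglyMeasurable, ?_⟩
    by_contra h
    rw [not_lt, top_le_iff] at h
    rw [h] at hFe
    exact hπ (by rw [← hFe]; simp)
  have hFi : Integrable F P := hF2.integrable (by norm_num)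
  let g : ℝ × (E × E) → E := P[F | m]
  have hgm : StronglyMeasurable[m] g := stronglyMeasurable_condExp
  obtain ⟨w, hwm, hw⟩ := hgm.exists_eq_measurable_comp
  have hgi : Integrable g P := integrable_condExp
  refine ⟨fun t x => w (t, x), hwm.measurable, ?_, ?_⟩
  · intro φ hφ hφc
    have hDc : Continuous (fderiv ℝ φ) := hφ.continuous_fderiv (by simp)
    obtain ⟨C, hC⟩ := (hφc.fderiv ℝ).exists_bound_of_continuous hDc
    let D : ℝ × (E × E) → (E →L[ℝ] ℝ) := fun q => fderiv ℝ φ (lineInterp q.1 q.2)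
    have hDm : StronglyMeasurable[m] D := by
      have : Measurable[m] T := comap_measurable T
      have h2 : StronglyMeasurable (fun q : ℝ × E => fderiv ℝ φ q.2) :=
        (hDc.comp continuous_snd).stronglyMeasurable
      exact h2.comp_measurable this
    have hDb : ∀ᵐ q ∂P, ‖D q‖ ≤ C := ae_of_all _ fun q => hC _
    have hpull : P[fun q => D q (F q) | m] =ᵐ[P] fun q => D q (g q) :=
      condExp_stronglyMeasurable_bilin_of_bound (ContinuousLinearMap.id ℝ (E →L[ℝ] ℝ)) hm hDm hFi C
        hDb
    have hDF : Integrable (fun q => D q (F q)) P :=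
      (ContinuousLinearMap.id ℝ (E →L[ℝ] ℝ)).integrable_of_bilin_of_bdd_left C
        (hDm.mono hm).aestronglyMeasurable hDb hFi
    have hDg : Integrable (fun q => D q (g q)) P :=
      (ContinuousLinearMap.id ℝ (E →L[ℝ] ℝ)).integrable_of_bilin_of_bdd_left C
        (hDm.mono hm).aestronglyMeasurable hDb hgi
    have hin : ∀ t : ℝ, ∫ x, fderiv ℝ φ x (w (t, x)) ∂(π.map (lineInterp t)) =
        ∫ p, D (t, p) (g (t, p)) ∂π := by
      intro t
      rw [integral_map (measurable_lineInterp t).aemeasurable]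
      · simp only [D, hw, T, Function.comp]
      · have h1 : Measurable (fun x => w (t, x)) := hwm.measurable.comp (by fun_prop)
        exact (isBoundedBilinearMap_apply.continuous.measurable.comp
          (hDc.measurable.prodMk h1)).aestronglyMeasurable
    simp only [hin]
    have hII : IntervalIntegrable (fun t => ∫ p, D (t, p) (g (t, p)) ∂π) volume 0 1 := by
      rw [intervalIntegrable_iff_integrableOn_Icc_of_le zero_le_one]
      exact hDg.integral_prod_left
    refine ⟨hII, ?_⟩
    have key : ∀ u ∈ Icc (0 : ℝ) 1, ∫ t in (0 : ℝ)..u, ∫ p, D (t, p) (g (t, p)) ∂π =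
        ∫ x, φ x ∂(π.map (lineInterp u)) - ∫ x, φ x ∂(π.map (lineInterp 0)) := by
      intro u hu
      have hsub : Ioc 0 u ⊆ Icc (0 : ℝ) 1 := fun t ht => ⟨ht.1.le, ht.2.trans hu.2⟩
      have hPr : P.restrict (Ioc 0 u ×ˢ univ) = (volume.restrict (Ioc 0 u)).prod π := by
        rw [← Measure.prod_restrict, Measure.restrict_restrict measurableSet_Ioc,
          Measure.restrict_univ, inter_eq_left.2 hsub]
      have hs : MeasurableSet[m] (Ioc 0 u ×ˢ (univ : Set (E × E))) :=
        ⟨Ioc 0 u ×ˢ univ, measurableSet_Ioc.prod MeasurableSet.univ, by ext; simp [T]⟩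
      have h1 := setIntegral_condExp hm hDF hs
      rw [setIntegral_congr_ae (hm _ hs) (hpull.mono fun q hq _ => hq), hPr] at h1
      have hDF' : Integrable (fun q => D q (F q)) ((volume.restrict (Ioc 0 u)).prod π) := by
        rw [← hPr]; exact hDF.restrict
      have hDg' : Integrable (fun q => D q (g q)) ((volume.restrict (Ioc 0 u)).prod π) := by
        rw [← hPr]; exact hDg.restrict
      rw [integral_prod _ hDg', integral_prod_symm _ hDF'] at h1
      rw [intervalIntegral.integral_of_le hu.1, h1]
      have hφi : ∀ s, Integrable (fun p => φ (lineInterp s p)) π := fun s => by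
        have : IsProbabilityMeasure (π.map (lineInterp s)) :=
          Measure.isProbabilityMeasure_map (measurable_lineInterp s).aemeasurable
        exact (hφ.continuous.integrable_of_hasCompactSupport hφc).comp_measurable
          (μ := π) (measurable_lineInterp s)
      rw [integral_map (measurable_lineInterp _).aemeasurable hφ.continuous.aestronglyMeasurable,
        integral_map (measurable_lineInterp _).aemeasurable hφ.continuous.aestronglyMeasurable,
        ← integral_sub (hφi _) (hφi _)]
      refine integral_congr_ae (ae_of_all _ fun p => ?_)
      have := integral_fderiv_lineInterp hφ p u
      rw [intervalIntegral.integral_of_le hu.1] at this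
      exact this
    intro s u hs hu
    have hsI : IntervalIntegrable (fun t => ∫ p, D (t, p) (g (t, p)) ∂π) volume 0 s :=
      hII.mono_set (by rw [uIcc_of_le hs.1, uIcc_of_le zero_le_one]; exact Icc_subset_Icc_right hs.2)
    have huI : IntervalIntegrable (fun t => ∫ p, D (t, p) (g (t, p)) ∂π) volume 0 u :=
      hII.mono_set (by rw [uIcc_of_le hu.1, uIcc_of_le zero_le_one]; exact Icc_subset_Icc_right hu.2)
    rw [← intervalIntegral.integral_interval_sub_left huI hsI, key u hu, key s hs]
    ring
  · rw [← hFe]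
    refine le_trans ?_ (pow_le_pow_left' (eLpNorm_condExp_le_eLpNorm (m := m) F (p := 2)
      (by norm_num)) 2)
    have : eLpNorm g 2 P ^ 2 = ∫⁻ q, ‖g q‖ₑ ^ 2 ∂P := by
      have := eLpNorm_nnreal_pow_eq_lintegral (f := g) (μ := P) (p := 2) (by simp)
      simpa using this
    change _ ≤ eLpNorm g 2 P ^ 2
    rw [this, lintegral_prod _ (((hgm.mono hm).enorm.pow_const 2).aemeasurable)]
    refine lintegral_mono fun t => ?_
    rw [lintegral_map _ (measurable_lineInterp t)]
    · refine lintegral_mono fun p => ?_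
      rw [hw, ← ofReal_norm, ← ENNReal.ofReal_pow (norm_nonneg _)]
      rfl
    · have h1 : Measurable (fun x => w (t, x)) := hwm.measurable.comp (by fun_prop)
      exact (h1.norm.pow_const 2).ennreal_ofReal

end Interpolation

section Duality

open scoped BoundedContinuousFunction CompactlySupported

variable {E : Type*} [NormedAddCommGroup E]

/-- The bounded continuous function `(x, y) ↦ a + f x + g y`. -/
noncomputable def splitSum (a : ℝ) (f g : C_c(E, ℝ)) : (E × E) →ᵇ ℝ :=
  BoundedContinuousFunction.const _ a
    + f.toBoundedContinuousFunction.compContinuous ⟨Prod.fst, continuous_fst⟩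
    + g.toBoundedContinuousFunction.compContinuous ⟨Prod.snd, continuous_snd⟩

@[simp] lemma splitSum_apply (a : ℝ) (f g : C_c(E, ℝ)) (p : E × E) :
    splitSum a f g p = a + f p.1 + g p.2 := rfl

/-- The tensor product of two compactly supported functions. -/
noncomputable def tensorCc (f g : C_c(E, ℝ)) : C_c(E × E, ℝ) where
  toFun p := f p.1 * g p.2
  continuous_toFun := by fun_prop
  hasCompactSupport' := by
    refine HasCompactSupport.intro (f.hasCompactSupport.prod g.hasCompactSupport) fun p hp => ?_
    by_cases h : p.1 ∈ tsupport f
    · have : p.2 ∉ tsupport g := fun h' => hp ⟨h, h'⟩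
      simp [image_eq_zero_of_notMem_tsupport this]
    · simp [image_eq_zero_of_notMem_tsupport h]

@[simp] lemma tensorCc_apply (f g : C_c(E, ℝ)) (p : E × E) :
    tensorCc f g p = f p.1 * g p.2 := rfl

/-- A continuous cutoff equal to `1` on the ball of radius `n` and to `0` outside the ball of
radius `n + 1`. -/
noncomputable def normCutoff (E : Type*) [NormedAddCommGroup E] [ProperSpace E] (n : ℕ) :
    C_c(E, ℝ) where
  toFun x := max 0 (min 1 (n + 1 - ‖x‖))
  continuous_toFun := by fun_prop
  hasCompactSupport' := by
    refine HasCompactSupport.intro (isCompact_closedBall (0 : E) (n + 1)) fun x hx => ?_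
    have : (n : ℝ) + 1 < ‖x‖ := by simpa using hx
    rw [max_eq_left]
    exact (min_le_right _ _).trans (by linarith)

section normCutoff

variable [ProperSpace E]

lemma normCutoff_apply (n : ℕ) (x : E) : normCutoff E n x = max 0 (min 1 (n + 1 - ‖x‖)) := rfl

lemma normCutoff_nonneg (n : ℕ) (x : E) : 0 ≤ normCutoff E n x := le_max_left _ _

lemma normCutoff_le_one (n : ℕ) (x : E) : normCutoff E n x ≤ 1 :=
  max_le zero_le_one (min_le_left _ _)

lemma normCutoff_mono (x : E) : Monotone fun n => normCutoff E n x := fun m n h => by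
  have : (m : ℝ) ≤ n := by exact_mod_cast h
  simp only [normCutoff_apply]
  gcongr

lemma tendsto_normCutoff (x : E) : Tendsto (fun n => normCutoff E n x) atTop (𝓝 1) := by
  refine tendsto_const_nhds.congr' ?_
  obtain ⟨N, hN⟩ := exists_nat_ge ‖x‖
  filter_upwards [eventually_ge_atTop N] with n hn
  have : (N : ℝ) ≤ n := by exact_mod_cast hn
  rw [normCutoff_apply, min_eq_left (by linarith), max_eq_right zero_le_one]

lemma tendsto_integral_normCutoff [MeasurableSpace E] [BorelSpace E] (μ : Measure E)
    [IsProbabilityMeasure μ] : Tendsto (fun n => ∫ x, normCutoff E n x ∂μ) atTop (𝓝 1) := by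
  have := tendsto_integral_of_dominated_convergence (μ := μ) (F := fun n x => normCutoff E n x)
    (f := fun _ => 1) (fun _ => 1)
    (fun n => (normCutoff E n).continuous.aestronglyMeasurable) (integrable_const _)
    (fun n => ae_of_all _ fun x => by
      rw [Real.norm_of_nonneg (normCutoff_nonneg n x)]; exact normCutoff_le_one n x)
    (ae_of_all _ tendsto_normCutoff)
  simpa using this

end normCutoff

variable [MeasurableSpace E] [BorelSpace E] [SecondCountableTopology E]

lemma integral_splitSum (μ ν : Measure E) [IsProbabilityMeasure μ] [IsProbabilityMeasure ν]
    (a : ℝ) (f g : C_c(E, ℝ)) :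
    ∫ p, splitSum a f g p ∂(μ.prod ν) = a + ∫ x, f x ∂μ + ∫ y, g y ∂ν := by
  have hf : Integrable (fun p : E × E => f p.1) (μ.prod ν) :=
    (f.continuous.integrable_of_hasCompactSupport f.hasCompactSupport).comp_fst ν
  have hg : Integrable (fun p : E × E => g p.2) (μ.prod ν) :=
    (g.continuous.integrable_of_hasCompactSupport g.hasCompactSupport).comp_snd μ
  simp only [splitSum_apply]
  have h1 := integral_add ((integrable_const (μ := μ.prod ν) a).add hf) hg
  have h2 := integral_add (integrable_const (μ := μ.prod ν) a) hf
  simp only [Pi.add_apply] at h1 h2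
  rw [h1, h2, integral_fun_fst, integral_fun_snd]
  simp

/-- Extension of the functional `a + f ⊕ g ↦ a + ∫ f dμ + ∫ g dν` to a positive functional on
bounded continuous functions under a bound on the dual Kantorovich problem. -/
lemma exists_positive_extension (μ ν : Measure E) [IsProbabilityMeasure μ]
    [IsProbabilityMeasure ν] {c : E × E → ℝ} (hc : ∀ p, 0 ≤ c p) {D : ℝ}
    (hD : ∀ (a : ℝ) (f g : C_c(E, ℝ)), (∀ x y, a + f x + g y ≤ c (x, y)) →
      a + ∫ x, f x ∂μ + ∫ y, g y ∂ν ≤ D) :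
    ∃ Λ : ((E × E) →ᵇ ℝ) →ₗ[ℝ] ℝ, (∀ F, (∀ p, 0 ≤ F p) → 0 ≤ Λ F) ∧
      (∀ a f g, Λ (splitSum a f g) = a + ∫ x, f x ∂μ + ∫ y, g y ∂ν) ∧
      ∀ F, (∀ p, F p ≤ c p) → Λ F ≤ D := by
  let K : PointedCone ℝ (((E × E) →ᵇ ℝ) × ℝ) :=
    { carrier := {q | 0 ≤ q.2 ∧ ∀ p, 0 ≤ q.1 p + q.2 * c p}
      add_mem' := by
        rintro q r ⟨hq1, hq2⟩ ⟨hr1, hr2⟩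
        refine ⟨add_nonneg hq1 hr1, fun p => ?_⟩
        have := add_nonneg (hq2 p) (hr2 p)
        simp only [Prod.fst_add, Prod.snd_add, BoundedContinuousFunction.coe_add, Pi.add_apply]
        linarith
      zero_mem' := by simp
      smul_mem' := by
        rintro ⟨t, ht⟩ q ⟨hq1, hq2⟩
        refine ⟨mul_nonneg ht hq1, fun p => ?_⟩
        have := mul_nonneg ht (hq2 p)
        change 0 ≤ t * q.1 p + t * q.2 * c p
        linarith }
  let S : Submodule ℝ (((E × E) →ᵇ ℝ) × ℝ) :=
    { carrier := {q | ∃ a f g, q.1 = splitSum a f g}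
      add_mem' := by
        rintro q r ⟨a, f, g, h⟩ ⟨a', f', g', h'⟩
        refine ⟨a + a', f + f', g + g', ?_⟩
        ext p
        simp [h, h']
        ring
      zero_mem' := ⟨0, 0, 0, by ext p; simp⟩
      smul_mem' := by
        rintro t q ⟨a, f, g, h⟩
        refine ⟨t * a, t • f, t • g, ?_⟩
        ext p
        simp [h]
        ring }
  let L : (((E × E) →ᵇ ℝ) × ℝ) →ₗ[ℝ] ℝ :=
    { toFun := fun q => ∫ p, q.1 p ∂(μ.prod ν) + q.2 * D
      map_add' := fun q r => by
        have := integral_add (q.1.integrable (μ.prod ν)) (r.1.integrable (μ.prod ν))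
        simp only [Prod.fst_add, Prod.snd_add, BoundedContinuousFunction.coe_add, Pi.add_apply]
        rw [this]
        ring
      map_smul' := fun t q => by
        have := integral_const_mul (μ := μ.prod ν) t q.1
        simp only [Prod.smul_fst, Prod.smul_snd, BoundedContinuousFunction.coe_smul, smul_eq_mul,
          RingHom.id_apply]
        rw [this]
        ring }
  obtain ⟨G, hG1, hG2⟩ := riesz_extension K ⟨S, L.comp S.subtype⟩ (by
    rintro ⟨⟨F, r⟩, a, f, g, h⟩ ⟨hr, hF⟩
    simp only at h
    subst h
    change 0 ≤ ∫ p, splitSum a f g p ∂(μ.prod ν) + r * D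
    change 0 ≤ r at hr
    change ∀ p, 0 ≤ splitSum a f g p + r * c p at hF
    rcases hr.eq_or_lt with rfl | hr
    · have : 0 ≤ ∫ p, splitSum a f g p ∂(μ.prod ν) :=
        integral_nonneg fun p => by simpa using hF p
      simpa using this
    · have h1 := hD (-r⁻¹ * a) ((-r⁻¹) • f) ((-r⁻¹) • g) (fun x y => by
        have h2 := mul_nonneg (inv_nonneg.2 hr.le) (hF (x, y))
        have h3 : r⁻¹ * (r * c (x, y)) = c (x, y) := by field_simp
        simp only [splitSum_apply, mul_add, h3] at h2
        simp only [CompactlySupportedContinuousMap.coe_smul, Pi.smul_apply, smul_eq_mul]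
        linarith)
      simp only [CompactlySupportedContinuousMap.coe_smul, Pi.smul_apply, smul_eq_mul,
        integral_const_mul] at h1
      rw [integral_splitSum]
      have h2 := mul_le_mul_of_nonneg_left h1 hr.le
      have h3 : r * (-r⁻¹ * a + -r⁻¹ * ∫ x, f x ∂μ + -r⁻¹ * ∫ x, g x ∂ν) =
          -(a + ∫ x, f x ∂μ + ∫ x, g x ∂ν) := by field_simp; ring
      linarith) (by
    rintro ⟨F, r⟩
    refine ⟨⟨(splitSum ‖F‖ 0 0, |r|), ‖F‖, 0, 0, rfl⟩, ?_⟩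
    have h1 : 0 ≤ |r| + r := by linarith [neg_abs_le r]
    refine ⟨h1, fun p => ?_⟩
    have h2 := (abs_le.1 (F.norm_coe_le_norm p)).1
    have h3 := mul_nonneg h1 (hc p)
    change 0 ≤ (splitSum ‖F‖ 0 0 p + F p) + (|r| + r) * c p
    simp only [splitSum_apply, CompactlySupportedContinuousMap.coe_zero, Pi.zero_apply]
    linarith)
  have hDval : G (0, 1) = D := by
    have := hG1 ⟨(0, 1), 0, 0, 0, by ext p; simp⟩
    refine this.trans ?_
    change ∫ p, (0 : (E × E) →ᵇ ℝ) p ∂(μ.prod ν) + 1 * D = D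
    simp
  refine ⟨G.comp (LinearMap.inl ℝ _ _), fun F hF => hG2 (F, 0) ⟨le_rfl, fun p => ?_⟩,
    fun a f g => ?_, fun F hF => ?_⟩
  · simpa using hF p
  · have := hG1 ⟨(splitSum a f g, 0), a, f, g, rfl⟩
    refine this.trans ?_
    change ∫ p, splitSum a f g p ∂(μ.prod ν) + 0 * D = _
    rw [integral_splitSum, zero_mul, add_zero]
  · have h1 : 0 ≤ G (-F, 1) := hG2 _ ⟨zero_le_one, fun p => by
      have := hF p
      simp only [BoundedContinuousFunction.coe_neg, Pi.neg_apply]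
      linarith⟩
    have h2 : ((-F, 1) : ((E × E) →ᵇ ℝ) × ℝ) = (0, 1) - (F, 0) := by ext <;> simp
    rw [h2, map_sub, hDval] at h1
    exact sub_nonneg.1 h1

/-- Kantorovich duality, as existence of a coupling whose cost is at most any upper bound of the
dual problem. -/
theorem exists_coupling_of_dual_le [ProperSpace E] (μ ν : Measure E) [IsProbabilityMeasure μ]
    [IsProbabilityMeasure ν] {c : E × E → ℝ} (hcc : Continuous c) (hc : ∀ p, 0 ≤ c p) {D : ℝ}
    (hD : ∀ (a : ℝ) (f g : C_c(E, ℝ)), (∀ x y, a + f x + g y ≤ c (x, y)) →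
      a + ∫ x, f x ∂μ + ∫ y, g y ∂ν ≤ D) :
    ∃ π : Measure (E × E), π.map Prod.fst = μ ∧ π.map Prod.snd = ν ∧
      ∫⁻ p, ENNReal.ofReal (c p) ∂π ≤ ENNReal.ofReal D := by
  obtain ⟨Λ, hΛ0, hΛs, hΛc⟩ := exists_positive_extension μ ν hc hD
  have hmono : ∀ F G : (E × E) →ᵇ ℝ, (∀ p, F p ≤ G p) → Λ F ≤ Λ G := fun F G h => by
    have := hΛ0 (G - F) fun p => by simpa using h p
    rw [map_sub] at this
    linarith
  let Λc : C_c(E × E, ℝ) →ₚ[ℝ] ℝ :=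
    { toFun := fun F => Λ F.toBoundedContinuousFunction
      map_add' := fun F G => by
        rw [← map_add]; rfl
      map_smul' := fun t F => by
        rw [RingHom.id_apply, ← map_smul]; rfl
      monotone' := fun F G h => hmono _ _ fun p => h p }
  let π : Measure (E × E) := RealRMK.rieszMeasure Λc
  have hπ : ∀ F : C_c(E × E, ℝ), ∫ p, F p ∂π = Λ F.toBoundedContinuousFunction :=
    fun F => RealRMK.integral_rieszMeasure Λc F
  have hbound : ∀ (q : E × E → ℝ) (B : ℝ), Continuous q → (∀ p, 0 ≤ q p) →
      (∀ F : (E × E) →ᵇ ℝ, (∀ p, F p ≤ q p) → Λ F ≤ B) →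
      ∫⁻ p, ENNReal.ofReal (q p) ∂π ≤ ENNReal.ofReal B := by
    intro q B hqc hq0 hqB
    let F : ℕ → C_c(E × E, ℝ) := fun n =>
      { toFun := fun p => q p * tensorCc (normCutoff E n) (normCutoff E n) p
        continuous_toFun := by fun_prop
        hasCompactSupport' :=
          (tensorCc (normCutoff E n) (normCutoff E n)).hasCompactSupport.mul_left }
    have hF : ∀ n p, F n p = q p * (normCutoff E n p.1 * normCutoff E n p.2) := fun _ _ => rfl
    have hF0 : ∀ n p, 0 ≤ F n p := fun n p => by
      rw [hF]
      exact mul_nonneg (hq0 p) (mul_nonneg (normCutoff_nonneg _ _) (normCutoff_nonneg _ _))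
    have hFq : ∀ n p, F n p ≤ q p := fun n p => by
      rw [hF]
      exact mul_le_of_le_one_right (hq0 p)
        (mul_le_one₀ (normCutoff_le_one _ _) (normCutoff_nonneg _ _) (normCutoff_le_one _ _))
    refine le_of_tendsto' (lintegral_tendsto_of_tendsto_of_monotone (μ := π)
      (f := fun n p => ENNReal.ofReal (F n p)) (F := fun p => ENNReal.ofReal (q p))
      (fun n => (F n).continuous.measurable.ennreal_ofReal.aemeasurable)
      (ae_of_all _ fun p m n h => ?_) (ae_of_all _ fun p => ?_)) fun n => ?_
    · simp only [hF]
      refine ENNReal.ofReal_le_ofReal (mul_le_mul_of_nonneg_left ?_ (hq0 p))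
      exact mul_le_mul (normCutoff_mono _ h) (normCutoff_mono _ h) (normCutoff_nonneg _ _)
        (normCutoff_nonneg _ _)
    · refine (ENNReal.continuous_ofReal.tendsto _).comp ?_
      simp only [hF]
      simpa using ((tendsto_normCutoff p.1).mul (tendsto_normCutoff p.2)).const_mul (q p)
    · rw [← ofReal_integral_eq_lintegral_ofReal
        ((map_continuous (F n)).integrable_of_hasCompactSupport (F n).hasCompactSupport)
        (ae_of_all _ (hF0 n)), hπ]
      exact ENNReal.ofReal_le_ofReal (hqB _ (hFq n))
  have hΛ1 : Λ (splitSum 1 0 0) = 1 := by rw [hΛs]; simp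
  have hfin : IsFiniteMeasure π := by
    have := hbound (fun _ => 1) 1 continuous_const (fun _ => zero_le_one) fun F hF => by
      refine (hmono F (splitSum 1 0 0) fun p => ?_).trans hΛ1.le
      simpa using hF p
    simp only [ENNReal.ofReal_one, lintegral_const, one_mul] at this
    exact ⟨this.trans_lt ENNReal.one_lt_top⟩
  have hlim : ∀ h : E × E → ℝ, ∀ C : ℝ, ∀ F : ℕ → C_c(E × E, ℝ), Continuous h →
      (∀ n p, |F n p| ≤ C) → (∀ p, Tendsto (fun n => F n p) atTop (𝓝 (h p))) →
      Tendsto (fun n => Λ (F n).toBoundedContinuousFunction) atTop (𝓝 (∫ p, h p ∂π)) := by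
    intro h C F hh hFC hFh
    simp only [← hπ]
    exact tendsto_integral_of_dominated_convergence (fun _ => C)
      (fun n => (F n).continuous.aestronglyMeasurable) (integrable_const _)
      (fun n => ae_of_all _ (hFC n)) (ae_of_all _ hFh)
  have hCc : ∀ f : C_c(E, ℝ), ∃ C : ℝ, 0 ≤ C ∧ ∀ x, |f x| ≤ C := fun f =>
    ⟨‖f.toBoundedContinuousFunction‖, norm_nonneg _,
      fun x => f.toBoundedContinuousFunction.norm_coe_le_norm x⟩
  have hcut : ∀ (C t : ℝ) (n : ℕ) (x : E), |t| ≤ C →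
      t * normCutoff E n x ≤ C + t - C * normCutoff E n x ∧
      -C + t + C * normCutoff E n x ≤ t * normCutoff E n x ∧ |t * normCutoff E n x| ≤ C := by
    intro C t n x ht
    have h0 := normCutoff_nonneg n x
    have h1 := normCutoff_le_one n x
    obtain ⟨h2, h3⟩ := abs_le.1 ht
    refine ⟨by nlinarith, by nlinarith, ?_⟩
    rw [abs_mul, abs_of_nonneg h0]
    nlinarith [abs_nonneg t]
  have hsq : ∀ (κ : Measure E) [IsProbabilityMeasure κ] (C t : ℝ) (A : ℕ → ℝ) (l : ℝ),
      Tendsto A atTop (𝓝 l) →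
      (∀ n, A n ≤ C + t - C * ∫ x, normCutoff E n x ∂κ) →
      (∀ n, -C + t + C * ∫ x, normCutoff E n x ∂κ ≤ A n) → l = t := by
    intro κ _ C t A l hA hu hl
    have hκ := (tendsto_integral_normCutoff κ).const_mul C
    refine tendsto_nhds_unique hA (tendsto_of_tendsto_of_tendsto_of_le_of_le
      (g := fun n => -C + t + C * ∫ x, normCutoff E n x ∂κ)
      (h := fun n => C + t - C * ∫ x, normCutoff E n x ∂κ) ?_ ?_ hl hu)
    · convert! hκ.const_add (-C + t) using 2; ring
    · convert! hκ.const_sub (C + t) using 2; ring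
  refine ⟨π, ?_, ?_, hbound c D hcc hc hΛc⟩
  · refine Measure.ext_of_integral_eq_on_compactlySupported fun f => ?_
    rw [integral_map measurable_fst.aemeasurable (map_continuous f).aestronglyMeasurable]
    obtain ⟨C, -, hC⟩ := hCc f
    refine hsq ν C _ _ _ (hlim (fun p => f p.1) C (fun n => tensorCc f (normCutoff E n))
      (by fun_prop) (fun n p => (hcut C _ n p.2 (hC p.1)).2.2)
      (fun p => by simpa using (tendsto_normCutoff p.2).const_mul (f p.1))) (fun n => ?_)
      (fun n => ?_)
    · refine (hmono _ (splitSum C f (-C • normCutoff E n)) fun p => ?_).trans_eq ?_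
      · simpa [sub_eq_add_neg] using (hcut C _ n p.2 (hC p.1)).1
      · rw [hΛs]; simp [integral_const_mul, integral_neg, sub_eq_add_neg]
    · refine le_of_eq_of_le ?_ (hmono (splitSum (-C) f (C • normCutoff E n)) _ fun p => ?_)
      · rw [hΛs]; simp [integral_const_mul]
      · simpa using (hcut C _ n p.2 (hC p.1)).2.1
  · refine Measure.ext_of_integral_eq_on_compactlySupported fun f => ?_
    rw [integral_map measurable_snd.aemeasurable (map_continuous f).aestronglyMeasurable]
    obtain ⟨C, -, hC⟩ := hCc f
    refine hsq μ C _ _ _ (hlim (fun p => f p.2) C (fun n => tensorCc (normCutoff E n) f)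
      (by fun_prop) (fun n p => by
        rw [tensorCc_apply, mul_comm]; exact (hcut C _ n p.1 (hC p.2)).2.2)
      (fun p => by simpa using (tendsto_normCutoff p.1).mul_const (f p.2))) (fun n => ?_)
      (fun n => ?_)
    · refine (hmono _ (splitSum C (-C • normCutoff E n) f) fun p => ?_).trans_eq ?_
      · have := (hcut C _ n p.1 (hC p.2)).1
        simp
        linarith
      · rw [hΛs]; simp [integral_const_mul, integral_neg]; ring
    · refine le_of_eq_of_le ?_ (hmono (splitSum (-C) (C • normCutoff E n) f) _ fun p => ?_)
      · rw [hΛs]; simp [integral_const_mul]; ring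
      · have := (hcut C _ n p.1 (hC p.2)).2.1
        simp
        linarith

end Duality

section Energy

/-- A bounded test function with bounded, Lipschitz derivative: smooth, compactly supported, with
derivative bounded by `A` and `B`-Lipschitz. -/
structure IsTestWithBounds {E : Type*} [NormedAddCommGroup E] [NormedSpace ℝ E] (A B : ℝ)
    (u : E → ℝ) : Prop where
  contDiff : ContDiff ℝ (⊤ : ℕ∞) u
  hasCompactSupport : HasCompactSupport u
  norm_fderiv_le : ∀ x, ‖fderiv ℝ u x‖ ≤ A
  norm_fderiv_sub_le : ∀ x y, ‖fderiv ℝ u x - fderiv ℝ u y‖ ≤ B * ‖x - y‖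

section TestFunctions

variable {E : Type*} [NormedAddCommGroup E] [InnerProductSpace ℝ E]
  {A B : ℝ} {u : E → ℝ}

lemma IsTestWithBounds.taylor_le (hu : IsTestWithBounds A B u) (hB : 0 ≤ B) (x q : E) :
    u (x - q) ≤ u x - fderiv ℝ u x q + B * ‖q‖ ^ 2 := by
  have h := (convex_segment x (x - q)).norm_image_sub_le_of_norm_fderiv_le' (f := u)
    (φ := fderiv ℝ u x) (C := B * ‖q‖)
    (fun y _ => hu.contDiff.differentiable (by simp) y) (fun y hy => ?_)
    (left_mem_segment ℝ _ _) (right_mem_segment ℝ _ _)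
  · simp only [sub_sub_cancel_left, map_neg, norm_neg, sub_neg_eq_add] at h
    have := (abs_le.1 (Real.norm_eq_abs _ ▸ h)).2
    nlinarith
  · refine (hu.norm_fderiv_sub_le y x).trans (mul_le_mul_of_nonneg_left ?_ hB)
    have := norm_sub_le_of_mem_segment hy
    simpa using this

lemma IsTestWithBounds.hasCompactSupport_normSq_fderiv (hu : IsTestWithBounds A B u) :
    HasCompactSupport fun x => ‖fderiv ℝ u x‖ ^ 2 / 4 :=
  (hu.hasCompactSupport.fderiv ℝ).comp_left (g := fun l => ‖l‖ ^ 2 / 4) (by simp)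

lemma IsTestWithBounds.norm_fderiv_normSq_fderiv_le (hu : IsTestWithBounds A B u) (hA : 0 ≤ A)
    (hB : 0 ≤ B) (x : E) : ‖fderiv ℝ (fun x => ‖fderiv ℝ u x‖ ^ 2 / 4) x‖ ≤ A * B := by
  have : LipschitzWith (Real.toNNReal (A * B)) fun x => ‖fderiv ℝ u x‖ ^ 2 / 4 := by
    refine LipschitzWith.of_dist_le_mul fun x y => ?_
    rw [Real.coe_toNNReal _ (by positivity), Real.dist_eq, dist_eq_norm]
    have h1 := (abs_norm_sub_norm_le _ _).trans (hu.norm_fderiv_sub_le x y)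
    have h2 := hu.norm_fderiv_le x
    have h3 := hu.norm_fderiv_le y
    have h4 : ‖fderiv ℝ u x‖ ^ 2 / 4 - ‖fderiv ℝ u y‖ ^ 2 / 4 =
      ((‖fderiv ℝ u x‖ + ‖fderiv ℝ u y‖) / 4) * (‖fderiv ℝ u x‖ - ‖fderiv ℝ u y‖) := by ring
    rw [h4, abs_mul, abs_of_nonneg (by positivity), mul_assoc]
    refine mul_le_mul ?_ h1 (abs_nonneg _) hA
    linarith
  simpa [Real.coe_toNNReal _ (mul_nonneg hA hB)] using norm_fderiv_le_of_lipschitz ℝ this (x₀ := x)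

variable [CompleteSpace E]

lemma IsTestWithBounds.le_of_transport_le (hu : IsTestWithBounds A B u) (hB : 0 ≤ B) {s : ℝ}
    (hs : 0 ≤ s) {w : E → ℝ} (hw : ∀ x p, w x ≤ u (x - s • p) + s * ‖p‖ ^ 2) (x : E) :
    w x ≤ u x - s * (‖fderiv ℝ u x‖ ^ 2 / 4) + s * (s * (B * A ^ 2)) := by
  let G : E := (InnerProductSpace.toDual ℝ E).symm (fderiv ℝ u x)
  have hG : ‖G‖ = ‖fderiv ℝ u x‖ := LinearIsometryEquiv.norm_map _ _
  have hDG : fderiv ℝ u x G = ‖fderiv ℝ u x‖ ^ 2 := by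
    rw [← InnerProductSpace.toDual_symm_apply, real_inner_self_eq_norm_sq, hG]
  have h1 := hw x ((1 / 2 : ℝ) • G)
  have h2 := hu.taylor_le hB x (s • (1 / 2 : ℝ) • G)
  simp only [map_smul, hDG, norm_smul, smul_eq_mul, Real.norm_eq_abs, hG] at h1 h2
  rw [abs_of_nonneg hs] at h2
  rw [abs_of_nonneg (by norm_num)] at h1 h2
  have h3 : ‖fderiv ℝ u x‖ ^ 2 ≤ A ^ 2 :=
    pow_le_pow_left₀ (norm_nonneg _) (hu.norm_fderiv_le x) 2
  have h4 : 0 ≤ s * s * B := by positivity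
  nlinarith [mul_le_mul_of_nonneg_left h3 h4, sq_nonneg ‖fderiv ℝ u x‖,
    mul_nonneg h4 (sq_nonneg ‖fderiv ℝ u x‖)]

lemma IsTestWithBounds.contDiff_normSq_fderiv (hu : IsTestWithBounds A B u) :
    ContDiff ℝ (⊤ : ℕ∞) fun x => ‖fderiv ℝ u x‖ ^ 2 / 4 := by
  have h1 : ContDiff ℝ (⊤ : ℕ∞) fun x => (InnerProductSpace.toDual ℝ E).symm (fderiv ℝ u x) :=
    (InnerProductSpace.toDual ℝ E).symm.contDiff.comp (hu.contDiff.fderiv_right (by simp))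
  simpa only [LinearIsometryEquiv.norm_map] using (h1.norm_sq ℝ).div_const 4

end TestFunctions

variable {d : ℕ} {α : ℝ → Measure (EuclideanSpace ℝ (Fin d))}
  {v : ℝ → EuclideanSpace ℝ (Fin d) → EuclideanSpace ℝ (Fin d)}

/-- Instantaneous kinetic energy. -/
noncomputable def kineticEnergy (α : ℝ → Measure (EuclideanSpace ℝ (Fin d)))
    (v : ℝ → EuclideanSpace ℝ (Fin d) → EuclideanSpace ℝ (Fin d)) (t : ℝ) : ℝ≥0∞ :=
  ∫⁻ x, ENNReal.ofReal (‖v t x‖ ^ 2) ∂(α t)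

/-- Kinetic energy of the curve on the time interval `(a, b]`. -/
noncomputable def kineticAction (α : ℝ → Measure (EuclideanSpace ℝ (Fin d)))
    (v : ℝ → EuclideanSpace ℝ (Fin d) → EuclideanSpace ℝ (Fin d)) (a b : ℝ) : ℝ :=
  (∫⁻ t in Ioc a b, kineticEnergy α v t).toReal

lemma kineticAction_nonneg (a b : ℝ) : 0 ≤ kineticAction α v a b := ENNReal.toReal_nonneg

lemma lintegral_Ioc_kineticEnergy_ne_top
    (hE : ∫⁻ t in Icc (0 : ℝ) 1, kineticEnergy α v t ≠ ⊤) {a b : ℝ} (ha : 0 ≤ a) (hb : b ≤ 1) :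
    ∫⁻ t in Ioc a b, kineticEnergy α v t ≠ ⊤ :=
  ne_top_of_le_ne_top hE
    (lintegral_mono_set (Ioc_subset_Icc_self.trans (Icc_subset_Icc ha hb)))

lemma kineticAction_add (hE : ∫⁻ t in Icc (0 : ℝ) 1, kineticEnergy α v t ≠ ⊤) {a b : ℝ}
    (ha : 0 ≤ a) (hab : a ≤ b) (hb : b ≤ 1) :
    kineticAction α v 0 b = kineticAction α v 0 a + kineticAction α v a b := by
  unfold kineticAction
  rw [← Ioc_union_Ioc_eq_Ioc ha hab, lintegral_union measurableSet_Ioc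
    (Ioc_disjoint_Ioc_of_le le_rfl), ENNReal.toReal_add
    (lintegral_Ioc_kineticEnergy_ne_top hE le_rfl (hab.trans hb))
    (lintegral_Ioc_kineticEnergy_ne_top hE ha hb)]

lemma ofReal_abs_integral_fderiv_le {φ : EuclideanSpace ℝ (Fin d) → ℝ} {M : ℝ} (hM : 0 ≤ M)
    (hφM : ∀ x, ‖fderiv ℝ φ x‖ ≤ M) {t : ℝ} [IsProbabilityMeasure (α t)] :
    ENNReal.ofReal |∫ x, fderiv ℝ φ x (v t x) ∂(α t)| ≤
      ENNReal.ofReal M * (1 + kineticEnergy α v t) := by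
  have h1 : ENNReal.ofReal |∫ x, fderiv ℝ φ x (v t x) ∂(α t)| ≤
      ∫⁻ x, ‖fderiv ℝ φ x (v t x)‖ₑ ∂(α t) := by
    rw [← Real.norm_eq_abs, ofReal_norm]
    exact enorm_integral_le_lintegral_enorm _
  have h2 : ∫⁻ _, 1 + ENNReal.ofReal (‖v t ‹_›‖ ^ 2) ∂(α t) = 1 + kineticEnergy α v t := by
    rw [lintegral_add_left measurable_const]
    simp [kineticEnergy]
  rw [← h2, ← lintegral_const_mul' _ _ ENNReal.ofReal_ne_top]
  refine h1.trans (lintegral_mono fun x => ?_)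
  rw [← ofReal_norm, ← ENNReal.ofReal_one, ← ENNReal.ofReal_add zero_le_one (by positivity),
    ← ENNReal.ofReal_mul hM]
  refine ENNReal.ofReal_le_ofReal ?_
  refine ((fderiv ℝ φ x).le_opNorm _).trans (mul_le_mul (hφM x) ?_ (norm_nonneg _) hM)
  nlinarith [sq_nonneg (‖v t x‖ - 1), sq_nonneg ‖v t x‖]

lemma abs_integral_sub_le (hα : ∀ t ∈ Icc (0 : ℝ) 1, IsProbabilityMeasure (α t))
    (hcont : SatisfiesContinuityEq α v)
    (hE : ∫⁻ t in Icc (0 : ℝ) 1, kineticEnergy α v t ≠ ⊤)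
    {φ : EuclideanSpace ℝ (Fin d) → ℝ} (hφ : ContDiff ℝ (⊤ : ℕ∞) φ) (hφc : HasCompactSupport φ)
    {M : ℝ} (hM : 0 ≤ M) (hφM : ∀ x, ‖fderiv ℝ φ x‖ ≤ M) {a b : ℝ} (ha : 0 ≤ a) (hab : a ≤ b)
    (hb : b ≤ 1) :
    |∫ x, φ x ∂(α b) - ∫ x, φ x ∂(α a)| ≤ M * ((b - a) + kineticAction α v a b) := by
  rw [(hcont φ hφ hφc).2 a b ⟨ha, hab.trans hb⟩ ⟨ha.trans hab, hb⟩,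
    intervalIntegral.integral_of_le hab]
  have hfin := lintegral_Ioc_kineticEnergy_ne_top hE ha hb
  have h2 : ∫⁻ t in Ioc a b, (1 + kineticEnergy α v t) =
      ENNReal.ofReal (b - a) + ∫⁻ t in Ioc a b, kineticEnergy α v t := by
    rw [lintegral_add_left measurable_const]
    simp
  have h3 : ENNReal.ofReal (M * ((b - a) + kineticAction α v a b)) =
      ENNReal.ofReal M * ∫⁻ t in Ioc a b, (1 + kineticEnergy α v t) := by
    rw [h2, ENNReal.ofReal_mul hM, ENNReal.ofReal_add (sub_nonneg.2 hab)
      (kineticAction_nonneg _ _), kineticAction, ENNReal.ofReal_toReal hfin]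
  have h4 : 0 ≤ M * ((b - a) + kineticAction α v a b) :=
    mul_nonneg hM (add_nonneg (sub_nonneg.2 hab) (kineticAction_nonneg _ _))
  rw [← ENNReal.ofReal_le_ofReal_iff h4, h3, ← Real.norm_eq_abs, ofReal_norm,
    ← lintegral_const_mul' _ _ ENNReal.ofReal_ne_top]
  refine (enorm_integral_le_lintegral_enorm _).trans (setLIntegral_mono' measurableSet_Ioc ?_)
  intro t ht
  have := hα t ⟨ha.trans ht.1.le, ht.2.trans hb⟩
  rw [← ofReal_norm, Real.norm_eq_abs]
  exact ofReal_abs_integral_fderiv_le hM hφM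

lemma ofReal_integral_fderiv_sub_le {u : EuclideanSpace ℝ (Fin d) → ℝ} {A B : ℝ}
    (hu : IsTestWithBounds A B u) {t : ℝ} [IsProbabilityMeasure (α t)] (hv : Measurable (v t)) :
    ENNReal.ofReal (∫ x, fderiv ℝ u x (v t x) ∂(α t) - ∫ x, ‖fderiv ℝ u x‖ ^ 2 / 4 ∂(α t)) ≤
      kineticEnergy α v t := by
  by_cases htop : kineticEnergy α v t = ⊤
  · simp [htop]
  have hsq : Integrable (fun x => ‖v t x‖ ^ 2) (α t) := by
    refine ⟨(hv.norm.pow_const 2).aestronglyMeasurable, ?_⟩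
    rw [hasFiniteIntegral_iff_ofReal (ae_of_all _ fun x => by positivity)]
    exact lt_top_iff_ne_top.2 htop
  have hψ : Integrable (fun x => ‖fderiv ℝ u x‖ ^ 2 / 4) (α t) :=
    hu.contDiff_normSq_fderiv.continuous.integrable_of_hasCompactSupport
      hu.hasCompactSupport_normSq_fderiv
  have hDc : Continuous (fderiv ℝ u) := hu.contDiff.continuous_fderiv (by simp)
  have hb : ∀ x, fderiv ℝ u x (v t x) ≤ ‖fderiv ℝ u x‖ ^ 2 / 4 + ‖v t x‖ ^ 2 ∧
      ‖fderiv ℝ u x (v t x)‖ ≤ ‖fderiv ℝ u x‖ ^ 2 / 4 + ‖v t x‖ ^ 2 := fun x => by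
    have h1 := (fderiv ℝ u x).le_opNorm (v t x)
    have h2 := sq_nonneg (‖fderiv ℝ u x‖ / 2 - ‖v t x‖)
    have h3 := le_abs_self (fderiv ℝ u x (v t x))
    rw [← Real.norm_eq_abs] at h3
    exact ⟨by nlinarith, by nlinarith⟩
  have hi : Integrable (fun x => fderiv ℝ u x (v t x)) (α t) := by
    refine (hψ.add hsq).mono' ?_ (ae_of_all _ fun x => (hb x).2)
    exact (isBoundedBilinearMap_apply.continuous.measurable.comp
      (hDc.measurable.prodMk hv)).aestronglyMeasurable
  rw [kineticEnergy, ← ofReal_integral_eq_lintegral_ofReal hsq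
    (ae_of_all _ fun x => by positivity), ← integral_sub hi hψ]
  refine ENNReal.ofReal_le_ofReal (integral_mono (hi.sub hψ) hsq fun x => ?_)
  have := (hb x).1
  simp only
  linarith

lemma continuousOn_integral (hcont : SatisfiesContinuityEq α v)
    {φ : EuclideanSpace ℝ (Fin d) → ℝ} (hφ : ContDiff ℝ (⊤ : ℕ∞) φ) (hφc : HasCompactSupport φ) :
    ContinuousOn (fun t => ∫ x, φ x ∂(α t)) (Icc 0 1) := by
  obtain ⟨h1, h2⟩ := hcont φ hφ hφc
  have h3 := intervalIntegral.continuousOn_primitive_interval' h1 (left_mem_uIcc)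
  rw [uIcc_of_le zero_le_one] at h3
  refine (h3.add (continuousOn_const (c := ∫ x, φ x ∂(α 0)))).congr fun t ht => ?_
  change _ = (∫ τ in (0 : ℝ)..t, ∫ x, fderiv ℝ φ x (v τ x) ∂(α τ)) + ∫ x, φ x ∂(α 0)
  rw [← h2 0 t (by simp) ht]
  ring

/-- One step of the dual estimate along a solution of the continuity equation. -/
lemma integral_step_le (hα : ∀ t ∈ Icc (0 : ℝ) 1, IsProbabilityMeasure (α t))
    (hv : Measurable (Function.uncurry v)) (hcont : SatisfiesContinuityEq α v)
    (hE : ∫⁻ t in Icc (0 : ℝ) 1, kineticEnergy α v t ≠ ⊤)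
    {u w : EuclideanSpace ℝ (Fin d) → ℝ} {A B : ℝ} (hA : 0 ≤ A) (hB : 0 ≤ B)
    (hu : IsTestWithBounds A B u) (hw : IsTestWithBounds A B w) {a s : ℝ} (ha : 0 ≤ a)
    (hs : 0 ≤ s) (hb : a + s ≤ 1) (huw : ∀ x p, w x ≤ u (x - s • p) + s * ‖p‖ ^ 2) :
    ∫ x, w x ∂(α (a + s)) - ∫ x, u x ∂(α a) ≤ kineticAction α v a (a + s) +
      s * (s * (B * A ^ 2) + A * B * (s + kineticAction α v a (a + s))) := by
  have hab : a ≤ a + s := by linarith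
  have hb1 : a + s ∈ Icc (0 : ℝ) 1 := ⟨by linarith, hb⟩
  have := hα _ hb1
  set ψ : EuclideanSpace ℝ (Fin d) → ℝ := fun x => ‖fderiv ℝ u x‖ ^ 2 / 4 with hψdef
  have hψs := hu.contDiff_normSq_fderiv
  have hψc := hu.hasCompactSupport_normSq_fderiv
  have hψi : Integrable ψ (α (a + s)) := hψs.continuous.integrable_of_hasCompactSupport hψc
  have hui : Integrable u (α (a + s)) :=
    hu.contDiff.continuous.integrable_of_hasCompactSupport hu.hasCompactSupport
  have hwi : Integrable w (α (a + s)) :=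
    hw.contDiff.continuous.integrable_of_hasCompactSupport hw.hasCompactSupport
  have h1 : ∫ x, w x ∂(α (a + s)) ≤ ∫ x, u x ∂(α (a + s)) - s * ∫ x, ψ x ∂(α (a + s)) +
      s * (s * (B * A ^ 2)) := by
    have h := integral_mono hwi ((hui.sub (hψi.const_mul s)).add
      (integrable_const (s * (s * (B * A ^ 2))))) fun x => hu.le_of_transport_le hB hs huw x
    have e1 := integral_add (hui.sub (hψi.const_mul s)) (integrable_const (s * (s * (B * A ^ 2))))
    have e2 := integral_sub hui (hψi.const_mul s)
    simp only [Pi.add_apply, Pi.sub_apply, integral_const_mul, integral_const, probReal_univ,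
      one_smul] at h e1 e2
    rw [e1, e2] at h
    exact h
  have hsubI : Ioc a (a + s) ⊆ Icc (0 : ℝ) 1 :=
    Ioc_subset_Icc_self.trans (Icc_subset_Icc ha hb)
  obtain ⟨hPi, hPe⟩ := hcont u hu.contDiff hu.hasCompactSupport
  have hPint : IntegrableOn (fun t => ∫ x, fderiv ℝ u x (v t x) ∂(α t)) (Ioc a (a + s)) := by
    rw [intervalIntegrable_iff_integrableOn_Icc_of_le zero_le_one] at hPi
    exact hPi.mono_set hsubI
  have hQint : IntegrableOn (fun t => ∫ x, ψ x ∂(α t)) (Ioc a (a + s)) :=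
    (continuousOn_integral hcont hψs hψc).integrableOn_Icc.mono_set hsubI
  have h2 := hPe a (a + s) ⟨ha, hab.trans hb⟩ hb1
  rw [intervalIntegral.integral_of_le hab] at h2
  have hfin := lintegral_Ioc_kineticEnergy_ne_top hE ha hb
  have h3 : ∫ t in Ioc a (a + s), (∫ x, fderiv ℝ u x (v t x) ∂(α t) - ∫ x, ψ x ∂(α t)) ≤
      kineticAction α v a (a + s) := by
    refine (integral_eq_lintegral_pos_part_sub_lintegral_neg_part (hPint.sub hQint)).le.trans ?_
    refine (sub_le_self _ ENNReal.toReal_nonneg).trans (ENNReal.toReal_mono hfin ?_)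
    refine setLIntegral_mono' measurableSet_Ioc fun t ht => ?_
    have := hα t (hsubI ht)
    exact ofReal_integral_fderiv_sub_le hu (hv.comp measurable_prodMk_left)
  have e : ∫ t in Ioc a (a + s), (∫ x, fderiv ℝ u x (v t x) ∂(α t) - ∫ x, ψ x ∂(α t)) =
      (∫ t in Ioc a (a + s), ∫ x, fderiv ℝ u x (v t x) ∂(α t)) -
        ∫ t in Ioc a (a + s), ∫ x, ψ x ∂(α t) := integral_sub hPint hQint
  rw [e, ← h2] at h3
  have h4 : ∫ t in Ioc a (a + s), ∫ x, ψ x ∂(α t) ≤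
      s * (∫ x, ψ x ∂(α (a + s)) + A * B * (s + kineticAction α v a (a + s))) := by
    have h5 : ∀ t ∈ Ioc a (a + s), ∫ x, ψ x ∂(α t) ≤
        ∫ x, ψ x ∂(α (a + s)) + A * B * (s + kineticAction α v a (a + s)) := fun t ht => by
      have h6 := abs_integral_sub_le hα hcont hE hψs hψc (mul_nonneg hA hB)
        (hu.norm_fderiv_normSq_fderiv_le hA hB) (ha.trans ht.1.le) ht.2 hb
      have h7 : kineticAction α v t (a + s) ≤ kineticAction α v a (a + s) :=
        ENNReal.toReal_mono hfin (lintegral_mono_set (Ioc_subset_Ioc_left ht.1.le))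
      have h8 : A * B * (a + s - t + kineticAction α v t (a + s)) ≤
          A * B * (s + kineticAction α v a (a + s)) :=
        mul_le_mul_of_nonneg_left (by linarith [ht.1]) (mul_nonneg hA hB)
      have h9 := (abs_le.1 h6).1
      linarith
    refine (setIntegral_mono_on hQint (integrableOn_const (by simp)) measurableSet_Ioc h5).trans_eq
      ?_
    simp [hs]
  linarith

/-- Telescoped form of the dual estimate. -/
lemma integral_telescope_le (hα : ∀ t ∈ Icc (0 : ℝ) 1, IsProbabilityMeasure (α t))
    (hv : Measurable (Function.uncurry v)) (hcont : SatisfiesContinuityEq α v)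
    (hE : ∫⁻ t in Icc (0 : ℝ) 1, kineticEnergy α v t ≠ ⊤)
    {u : ℝ → EuclideanSpace ℝ (Fin d) → ℝ} {A B : ℝ} (hA : 0 ≤ A) (hB : 0 ≤ B)
    (hu : ∀ t ∈ Icc (0 : ℝ) 1, IsTestWithBounds A B (u t))
    (hut : ∀ t s, 0 ≤ t → 0 ≤ s → ∀ x p, u (t + s) x ≤ u t (x - s • p) + s * ‖p‖ ^ 2) :
    ∫ x, u 1 x ∂(α 1) - ∫ x, u 0 x ∂(α 0) ≤ kineticAction α v 0 1 := by
  have key : ∀ N : ℕ, 0 < N → ∫ x, u 1 x ∂(α 1) - ∫ x, u 0 x ∂(α 0) ≤ kineticAction α v 0 1 +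
      (1 / N : ℝ) * (B * A ^ 2 + A * B * (1 + kineticAction α v 0 1)) := by
    intro N hN
    have hN' : (0 : ℝ) < N := by exact_mod_cast hN
    have hind : ∀ k : ℕ, k ≤ N → ∫ x, u (k / N) x ∂(α (k / N)) - ∫ x, u 0 x ∂(α 0) ≤
        kineticAction α v 0 (k / N) + (1 / N : ℝ) *
          (k / N * (B * A ^ 2) + A * B * (k / N + kineticAction α v 0 (k / N))) := by
      intro k
      induction k with
      | zero => intro _; simp [kineticAction]
      | succ k ih =>
        intro hk
        have ih := ih (by omega)
        have hk' : ((k : ℝ) + 1) / N ≤ 1 := by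
          rw [div_le_one hN']; exact_mod_cast hk
        have hs : (0 : ℝ) ≤ 1 / N := by positivity
        have ha : (0 : ℝ) ≤ k / N := by positivity
        have hadd : (k : ℝ) / N + 1 / N = (k + 1) / N := by ring
        have h1 : (k : ℝ) / N + 1 / N ≤ 1 := hadd ▸ hk'
        have hstep := integral_step_le hα hv hcont hE hA hB (hu _ ⟨ha, by linarith⟩)
          (hu _ ⟨by linarith, h1⟩) ha hs h1 (hut _ _ ha hs)
        have hJ := kineticAction_add (v := v) (α := α) hE ha (b := k / N + 1 / N)
          (by linarith) h1
        push_cast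
        rw [← hadd, hJ]
        nlinarith
    have := hind N le_rfl
    rw [div_self hN'.ne'] at this
    simpa using this
  have hlim : Tendsto (fun N : ℕ => kineticAction α v 0 1 +
      (1 / N : ℝ) * (B * A ^ 2 + A * B * (1 + kineticAction α v 0 1))) atTop
      (𝓝 (kineticAction α v 0 1)) := by
    simpa using (tendsto_one_div_atTop_nhds_zero_nat.mul_const
      (B * A ^ 2 + A * B * (1 + kineticAction α v 0 1))).const_add (kineticAction α v 0 1)
  exact ge_of_tendsto hlim ((eventually_gt_atTop 0).mono key)

end Energy

section HopfLax

variable {E : Type*} [NormedAddCommGroup E] [NormedSpace ℝ E]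

/-- The Hopf–Lax semigroup for the quadratic cost, applied to `h` at time `t`. -/
noncomputable def hopfLax (h : E → ℝ) (t : ℝ) (x : E) : ℝ :=
  ⨅ z, (h (x - t • z) + t * ‖z‖ ^ 2)

variable {h : E → ℝ} {M : ℝ}

lemma bddBelow_hopfLax (hM : ∀ x, |h x| ≤ M) {t : ℝ} (ht : 0 ≤ t) (x : E) :
    BddBelow (range fun z => h (x - t • z) + t * ‖z‖ ^ 2) := by
  refine ⟨-M, ?_⟩
  rintro _ ⟨z, rfl⟩
  have h1 := (abs_le.1 (hM (x - t • z))).1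
  have h2 : 0 ≤ t * ‖z‖ ^ 2 := by positivity
  dsimp only
  linarith

lemma hopfLax_le (hM : ∀ x, |h x| ≤ M) {t : ℝ} (ht : 0 ≤ t) (x z : E) :
    hopfLax h t x ≤ h (x - t • z) + t * ‖z‖ ^ 2 :=
  ciInf_le (bddBelow_hopfLax hM ht x) z

lemma hopfLax_le_self (hM : ∀ x, |h x| ≤ M) {t : ℝ} (ht : 0 ≤ t) (x : E) :
    hopfLax h t x ≤ h x := by
  simpa using hopfLax_le hM ht x 0

lemma abs_hopfLax_le (hM : ∀ x, |h x| ≤ M) {t : ℝ} (ht : 0 ≤ t) (x : E) :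
    |hopfLax h t x| ≤ M := by
  refine abs_le.2 ⟨le_ciInf fun z => ?_, (hopfLax_le_self hM ht x).trans (abs_le.1 (hM x)).2⟩
  have h1 := (abs_le.1 (hM (x - t • z))).1
  have h2 : 0 ≤ t * ‖z‖ ^ 2 := by positivity
  linarith

lemma hopfLax_zero (h : E → ℝ) (x : E) : hopfLax h 0 x = h x := by
  simp [hopfLax]

lemma hopfLax_add_le (hM : ∀ x, |h x| ≤ M) {t s : ℝ} (ht : 0 ≤ t) (hs : 0 ≤ s) (x p : E) :
    hopfLax h (t + s) x ≤ hopfLax h t (x - s • p) + s * ‖p‖ ^ 2 := by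
  rw [← sub_le_iff_le_add]
  refine le_ciInf fun z => sub_le_iff_le_add.2 ?_
  rcases (add_nonneg ht hs).eq_or_lt with h0 | h0
  · have ht0 : t = 0 := by linarith
    have hs0 : s = 0 := by linarith
    subst ht0 hs0
    simpa using hopfLax_le hM le_rfl x z
  · have h1 := hopfLax_le hM h0.le x ((t + s)⁻¹ • (t • z + s • p))
    rw [smul_inv_smul₀ h0.ne', ← sub_sub, sub_right_comm] at h1
    refine h1.trans ?_
    have h2 : ‖t • z + s • p‖ ≤ t * ‖z‖ + s * ‖p‖ := by
      refine (norm_add_le _ _).trans_eq ?_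
      rw [norm_smul_of_nonneg ht, norm_smul_of_nonneg hs]
    have h3 : (t + s) * ‖(t + s)⁻¹ • (t • z + s • p)‖ ^ 2 ≤ t * ‖z‖ ^ 2 + s * ‖p‖ ^ 2 := by
      rw [norm_smul_of_nonneg (inv_nonneg.2 h0.le), mul_pow]
      have h4 : (t + s) * ((t + s)⁻¹ ^ 2 * ‖t • z + s • p‖ ^ 2) =
          ‖t • z + s • p‖ ^ 2 / (t + s) := by field_simp
      rw [h4, div_le_iff₀ h0]
      have h5 := pow_le_pow_left₀ (norm_nonneg _) h2 2
      nlinarith [mul_nonneg (mul_nonneg ht hs) (sq_nonneg (‖z‖ - ‖p‖))]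
    linarith

lemma dist_hopfLax_le (hM : ∀ x, |h x| ≤ M) {δ η : ℝ}
    (hh : ∀ x y, dist x y < δ → dist (h x) (h y) ≤ η) {t : ℝ} (ht : 0 ≤ t) {x y : E}
    (hxy : dist x y < δ) : dist (hopfLax h t x) (hopfLax h t y) ≤ η := by
  have key : ∀ x y : E, dist x y < δ → hopfLax h t x ≤ hopfLax h t y + η := fun x y hxy => by
    rw [← sub_le_iff_le_add]
    refine le_ciInf fun z => ?_
    have h1 := hopfLax_le hM ht x z
    have h2 := hh (x - t • z) (y - t • z) (by simpa using hxy)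
    have h3 := (abs_le.1 (Real.dist_eq _ _ ▸ h2)).2
    linarith
  rw [Real.dist_eq, abs_le]
  have h1 := key x y hxy
  have h2 := key y x (dist_comm x y ▸ hxy)
  constructor <;> linarith

lemma continuous_hopfLax (hM : ∀ x, |h x| ≤ M) (hh : UniformContinuous h) {t : ℝ} (ht : 0 ≤ t) :
    Continuous (hopfLax h t) := by
  refine (Metric.uniformContinuous_iff.2 fun ε hε => ?_).continuous
  obtain ⟨δ, hδ, H⟩ := Metric.uniformContinuous_iff.1 hh (ε / 2) (by positivity)
  exact ⟨δ, hδ, fun {x y} hxy => (dist_hopfLax_le hM (fun x y hxy => (H hxy).le) ht hxy).trans_lt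
    (by linarith)⟩

lemma hopfLax_eq_zero (hM : ∀ x, |h x| ≤ M) {R : ℝ} (hR : ∀ x, R < ‖x‖ → h x = 0) {t : ℝ}
    (ht : 0 ≤ t) (ht1 : t ≤ 1) {x : E} (hx : max R 0 + √M < ‖x‖) : hopfLax h t x = 0 := by
  have hM0 : 0 ≤ M := (abs_nonneg _).trans (hM 0)
  have hRx : R < ‖x‖ := by linarith [le_max_left R 0, Real.sqrt_nonneg M]
  refine le_antisymm ((hopfLax_le_self hM ht x).trans_eq (hR x hRx)) (le_ciInf fun z => ?_)
  have h2 : 0 ≤ t * ‖z‖ ^ 2 := by positivity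
  by_cases hz : R < ‖x - t • z‖
  · rw [hR _ hz]
    linarith
  · have h1 := (abs_le.1 (hM (x - t • z))).1
    suffices M ≤ t * ‖z‖ ^ 2 by linarith
    have h3 : ‖x‖ ≤ ‖x - t • z‖ + t * ‖z‖ := by
      rw [← norm_smul_of_nonneg ht]
      simpa using norm_add_le (x - t • z) (t • z)
    have h4 : √M ≤ t * ‖z‖ := by linarith [le_max_left R 0]
    calc M = √M ^ 2 := (Real.sq_sqrt hM0).symm
      _ ≤ (t * ‖z‖) ^ 2 := pow_le_pow_left₀ (Real.sqrt_nonneg _) h4 2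
      _ = t * (t * ‖z‖ ^ 2) := by ring
      _ ≤ 1 * (t * ‖z‖ ^ 2) := mul_le_mul_of_nonneg_right ht1 h2
      _ = t * ‖z‖ ^ 2 := one_mul _

end HopfLax

section Mollification

open scoped Convolution

variable {E : Type*} [NormedAddCommGroup E] [InnerProductSpace ℝ E] [FiniteDimensional ℝ E]
  [MeasurableSpace E] [BorelSpace E]

/-- The mollification of `g` by a normalized bump function. -/
noncomputable def mollify (ρ : ContDiffBump (0 : E)) (g : E → ℝ) : E → ℝ :=
  (ρ.normed volume) ⋆[ContinuousLinearMap.lsmul ℝ ℝ, volume] g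

variable (ρ : ContDiffBump (0 : E)) {g : E → ℝ}

lemma integrable_mollify (hg : Continuous g) (x : E) :
    Integrable (fun z => ρ.normed volume z * g (x - z)) :=
  (ρ.hasCompactSupport_normed.convolutionExists_left (ContinuousLinearMap.lsmul ℝ ℝ)
    ρ.continuous_normed hg.locallyIntegrable) x

lemma mollify_apply (x : E) : mollify ρ g x = ∫ z, ρ.normed volume z * g (x - z) := rfl

lemma mollify_le_add {g' : E → ℝ} (hg : Continuous g) (hg' : Continuous g') {q : E} {c : ℝ}
    (H : ∀ x, g' x ≤ g (x - q) + c) (x : E) : mollify ρ g' x ≤ mollify ρ g (x - q) + c := by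
  have h1 : c = ∫ z, ρ.normed volume z * c := by
    rw [integral_mul_const, ρ.integral_normed, one_mul]
  have hc : Integrable (fun z => ρ.normed volume z * c) := ρ.integrable_normed.mul_const c
  rw [h1, mollify_apply, mollify_apply, ← integral_add (integrable_mollify ρ hg _) hc]
  refine integral_mono (integrable_mollify ρ hg' x)
    ((integrable_mollify ρ hg (x - q)).add hc) fun z => ?_
  have h2 := mul_le_mul_of_nonneg_left (H (x - z)) (ρ.nonneg_normed (μ := volume) z)
  rw [sub_right_comm] at h2
  linarith

/-- Mollification turns uniformly bounded, uniformly compactly supported continuous functions into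
test functions with uniform bounds. -/
lemma exists_isTestWithBounds_mollify (M R : ℝ) : ∃ A B : ℝ, 0 ≤ A ∧ 0 ≤ B ∧
    ∀ g : E → ℝ, Continuous g → (∀ x, |g x| ≤ M) → (∀ x, R < ‖x‖ → g x = 0) →
      IsTestWithBounds A B (mollify ρ g) := by
  set f : E → ℝ := ρ.normed volume with hf
  have hfs : ContDiff ℝ (⊤ : ℕ∞) f := ρ.contDiff_normed
  have hfc : HasCompactSupport f := ρ.hasCompactSupport_normed
  have hD : ContDiff ℝ 1 (fderiv ℝ f) := 
    (hfs.fderiv_right (m := (⊤ : ℕ∞)) (by simp)).of_le (by simp)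
  obtain ⟨C, hC⟩ := (hfc.fderiv ℝ).exists_bound_of_continuous hD.continuous
  obtain ⟨K, hK⟩ := hD.lipschitzWith_of_hasCompactSupport (hfc.fderiv ℝ) (by simp)
  have hC0 : 0 ≤ C := (norm_nonneg _).trans (hC 0)
  set V : ℝ := volume.real (Metric.closedBall (0 : E) R)
  have hV : 0 ≤ V := measureReal_nonneg
  refine ⟨C * (|M| * V), K * (|M| * V), by positivity, by positivity, fun g hg hgM hgR => ?_⟩
  have hgc : HasCompactSupport g := HasCompactSupport.of_support_subset_isCompact
    (isCompact_closedBall (0 : E) R) fun x hx => by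
      by_contra hxR
      exact hx (hgR x (by simpa using hxR))
  have hgi : Integrable g := hg.integrable_of_hasCompactSupport hgc
  have hint : ∫ x, ‖g x‖ ≤ |M| * V := by
    rw [← setIntegral_eq_integral_of_forall_compl_eq_zero (s := Metric.closedBall (0 : E) R)
      fun x hx => by rw [hgR x (by simpa using hx), norm_zero]]
    refine (setIntegral_mono_on hgi.norm.integrableOn (integrableOn_const
      (C := |M|) (isCompact_closedBall (0 : E) R).measure_lt_top.ne) measurableSet_closedBall
      fun x _ => (hgM x).trans (le_abs_self M)).trans_eq ?_
    rw [setIntegral_const, smul_eq_mul, mul_comm]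
  set L := (ContinuousLinearMap.lsmul ℝ ℝ : ℝ →L[ℝ] ℝ →L[ℝ] ℝ).precompL E
  have hL : ∀ (l : E →L[ℝ] ℝ) (c : ℝ), ‖L l c‖ ≤ ‖l‖ * ‖c‖ := fun l c => by
    refine ContinuousLinearMap.opNorm_le_bound _ (by positivity) fun z => ?_
    rw [ContinuousLinearMap.precompL_apply, ContinuousLinearMap.lsmul_apply, norm_smul,
      mul_right_comm]
    exact mul_le_mul_of_nonneg_right (l.le_opNorm z) (norm_nonneg _)
  have hderiv : ∀ x, fderiv ℝ (mollify ρ g) x = ∫ z, L (fderiv ℝ f (x - z)) (g z) := fun x => by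
    rw [mollify, (hfc.hasFDerivAt_convolution_left _ (hfs.of_le (by simp))
      hg.locallyIntegrable x).fderiv, convolution_eq_swap]
  have hex : ∀ x, Integrable fun z => L (fderiv ℝ f (x - z)) (g z) := fun x => by
    refine (hgi.norm.const_mul C).mono' ?_ (ae_of_all _ fun z => (hL _ _).trans
      (mul_le_mul_of_nonneg_right (hC _) (norm_nonneg _)))
    exact (L.isBoundedBilinearMap.continuous.comp
      ((hD.continuous.comp (continuous_const.sub continuous_id)).prodMk hg)).aestronglyMeasurable
  refine ⟨hfc.contDiff_convolution_left _ hfs hg.locallyIntegrable,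
    hfc.convolution _ hgc, fun x => ?_, fun x y => ?_⟩
  · rw [hderiv]
    refine (norm_integral_le_of_norm_le (hgi.norm.const_mul C) (ae_of_all _ fun z =>
      (hL _ _).trans (mul_le_mul_of_nonneg_right (hC _) (norm_nonneg _)))).trans ?_
    rw [integral_const_mul]
    exact mul_le_mul_of_nonneg_left hint hC0
  · rw [hderiv, hderiv, ← integral_sub (hex x) (hex y)]
    refine (norm_integral_le_of_norm_le (hgi.norm.const_mul (K * ‖x - y‖)) (ae_of_all _ fun z =>
      ?_)).trans ?_
    · rw [← sub_apply, ← map_sub]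
      refine (hL _ _).trans (mul_le_mul_of_nonneg_right ?_ (norm_nonneg _))
      simpa using hK.norm_sub_le (x - z) (y - z)
    · rw [integral_const_mul, mul_right_comm]
      exact mul_le_mul_of_nonneg_right (mul_le_mul_of_nonneg_left hint K.2) (norm_nonneg _)

end Mollification

section Duality

variable {d : ℕ} {α : ℝ → Measure (EuclideanSpace ℝ (Fin d))}
  {v : ℝ → EuclideanSpace ℝ (Fin d) → EuclideanSpace ℝ (Fin d)}

open scoped CompactlySupported

/-- The Hopf–Lax evolution of a compactly supported function is a dual competitor for the kinetic
action. -/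
lemma integral_hopfLax_sub_le (hα : ∀ t ∈ Icc (0 : ℝ) 1, IsProbabilityMeasure (α t))
    (hv : Measurable (Function.uncurry v)) (hcont : SatisfiesContinuityEq α v)
    (hE : ∫⁻ t in Icc (0 : ℝ) 1, kineticEnergy α v t ≠ ⊤)
    {h : EuclideanSpace ℝ (Fin d) → ℝ} (hc : Continuous h) (hs : HasCompactSupport h) :
    ∫ x, hopfLax h 1 x ∂(α 1) - ∫ x, h x ∂(α 0) ≤ kineticAction α v 0 1 := by
  have := hα 0 (by simp)
  have := hα 1 (by simp)
  obtain ⟨M, hM⟩ := hs.exists_bound_of_continuous hc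
  obtain ⟨R, hR⟩ := hs.isCompact.isBounded.subset_closedBall 0
  have hR' : ∀ x, R < ‖x‖ → h x = 0 := fun x hx => image_eq_zero_of_notMem_tsupport fun hx' =>
    absurd (mem_closedBall_zero_iff.1 (hR hx')) (not_le.2 hx)
  have hu : UniformContinuous h := hs.uniformContinuous_of_continuous hc
  have hUc : ∀ t, 0 ≤ t → Continuous (hopfLax h t) := fun t ht => continuous_hopfLax hM hu ht
  have hUi : Integrable (hopfLax h 1) (α 1) := .of_bound (hUc 1 zero_le_one).aestronglyMeasurable
    M (ae_of_all _ fun x => abs_hopfLax_le hM zero_le_one x)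
  have hhi : Integrable h (α 0) := hc.integrable_of_hasCompactSupport hs
  refine le_of_forall_pos_le_add fun ε hε => ?_
  obtain ⟨δ, hδ, hδε⟩ := Metric.uniformContinuous_iff.1 hu (ε / 2) (by positivity)
  let ρ : ContDiffBump (0 : EuclideanSpace ℝ (Fin d)) := ⟨δ / 2, δ, by positivity, by linarith⟩
  obtain ⟨A, B, hA, hB, hAB⟩ := exists_isTestWithBounds_mollify ρ M (max R 0 + √M)
  have htest : ∀ t ∈ Icc (0 : ℝ) 1, IsTestWithBounds A B (mollify ρ (hopfLax h t)) := fun t ht =>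
    hAB _ (hUc t ht.1) (abs_hopfLax_le hM ht.1) fun x hx => hopfLax_eq_zero hM hR' ht.1 ht.2 hx
  have hmain := integral_telescope_le hα hv hcont hE hA hB htest fun t s ht hs x p =>
    mollify_le_add ρ (hUc t ht) (hUc _ (add_nonneg ht hs)) (hopfLax_add_le hM ht hs · p) x
  have hclose : ∀ t, 0 ≤ t → ∀ x, |mollify ρ (hopfLax h t) x - hopfLax h t x| ≤ ε / 2 :=
    fun t ht x => by
      rw [← Real.dist_eq]
      exact ρ.dist_normed_convolution_le (hUc t ht).aestronglyMeasurable fun y hy =>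
        dist_hopfLax_le hM (fun x y hxy => (hδε hxy).le) ht hy
  have hi : ∀ t ∈ Icc (0 : ℝ) 1, Integrable (mollify ρ (hopfLax h t)) (α t) := fun t ht => by
    have := hα t ht
    exact (htest t ht).contDiff.continuous.integrable_of_hasCompactSupport
      (htest t ht).hasCompactSupport
  have h1 : ∫ x, hopfLax h 1 x ∂(α 1) ≤ ∫ x, mollify ρ (hopfLax h 1) x ∂(α 1) + ε / 2 := by
    have := integral_mono hUi ((hi 1 (by simp)).add (integrable_const (ε / 2))) fun x => by
      have := (abs_le.1 (hclose 1 zero_le_one x)).1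
      simp only [Pi.add_apply]
      linarith
    rw [integral_add' (hi 1 (by simp)) (integrable_const _)] at this
    simpa using this
  have h0 : ∫ x, mollify ρ (hopfLax h 0) x ∂(α 0) ≤ ∫ x, h x ∂(α 0) + ε / 2 := by
    have := integral_mono (hi 0 (by simp)) (hhi.add (integrable_const (ε / 2))) fun x => by
      have := (abs_le.1 (hclose 0 le_rfl x)).2
      rw [hopfLax_zero] at this
      simp only [Pi.add_apply]
      linarith
    rw [integral_add' hhi (integrable_const _)] at this
    simpa using this
  linarith

lemma W2sq_le_lintegral_kineticEnergy (hα : ∀ t ∈ Icc (0 : ℝ) 1, IsProbabilityMeasure (α t))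
    (hv : Measurable (Function.uncurry v)) (hcont : SatisfiesContinuityEq α v) :
    W2sq (α 0) (α 1) ≤ ∫⁻ t in Icc (0 : ℝ) 1, kineticEnergy α v t := by
  by_cases hE : ∫⁻ t in Icc (0 : ℝ) 1, kineticEnergy α v t = ⊤
  · simp [hE]
  have := hα 0 (by simp)
  have := hα 1 (by simp)
  obtain ⟨π, hπ0, hπ1, hπ⟩ := exists_coupling_of_dual_le (α 0) (α 1)
    (c := fun p => ‖p.1 - p.2‖ ^ 2) (by fun_prop) (fun p => by positivity)
    (D := kineticAction α v 0 1) fun a f g hfg => by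
      have hfc : Continuous fun x => -f x := f.continuous.neg
      have hfs : HasCompactSupport fun x => -f x := f.hasCompactSupport.neg
      have h1 := integral_hopfLax_sub_le hα hv hcont hE hfc hfs
      obtain ⟨M, hM⟩ := hfs.exists_bound_of_continuous hfc
      have hUi : Integrable (hopfLax (fun x => -f x) 1) (α 1) := .of_bound
        (continuous_hopfLax hM (hfs.uniformContinuous_of_continuous hfc)
          zero_le_one).aestronglyMeasurable M (ae_of_all _ fun x => abs_hopfLax_le hM zero_le_one x)
      have hgi : Integrable g (α 1) :=
        g.continuous.integrable_of_hasCompactSupport g.hasCompactSupport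
      have h2 := integral_mono ((integrable_const a).add hgi) hUi fun y => le_ciInf fun z => by
        have := hfg (y - (1 : ℝ) • z) y
        simp only [one_smul, sub_sub_cancel_left, norm_neg] at this
        simp only [Pi.add_apply, one_smul, one_mul]
        linarith
      rw [integral_add' (integrable_const _) hgi] at h2
      simp only [integral_const, probReal_univ, one_smul] at h2
      rw [integral_neg] at h1
      linarith
  refine (iInf_le_of_le π (iInf₂_le_of_le hπ0 hπ1 hπ)).trans ?_
  rw [kineticAction, ENNReal.ofReal_toReal (lintegral_Ioc_kineticEnergy_ne_top hE le_rfl le_rfl)]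
  exact lintegral_mono_set Ioc_subset_Icc_self

end Duality

/-- **Benamou–Brenier formula.** For probability measures `α₀, α₁` on `ℝ^d` with finite
second moments, `W₂²(α₀,α₁)` equals the infimum, over all curves of probability measures
`(α_t)_{t∈[0,1]}` joining `α₀` to `α₁` and all Borel velocity fields `v` solving the
continuity equation in the weak sense, of the kinetic energy `∫₀¹ ∫ ‖v_t‖² dα_t dt`. -/
theorem benamou_brenier
    (d : ℕ) (α₀ α₁ : Measure (EuclideanSpace ℝ (Fin d)))
    [IsProbabilityMeasure α₀] [IsProbabilityMeasure α₁]
    (hm₀ : Integrable (fun x => ‖x‖ ^ 2) α₀) (hm₁ : Integrable (fun x => ‖x‖ ^ 2) α₁) :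
    W2sq α₀ α₁ =
      ⨅ (α : ℝ → Measure (EuclideanSpace ℝ (Fin d)))
        (v : ℝ → EuclideanSpace ℝ (Fin d) → EuclideanSpace ℝ (Fin d))
        (_ : ∀ t ∈ Set.Icc (0 : ℝ) 1, IsProbabilityMeasure (α t))
        (_ : α 0 = α₀) (_ : α 1 = α₁)
        (_ : Measurable (Function.uncurry v))
        (_ : SatisfiesContinuityEq α v),
        ∫⁻ t in Set.Icc (0 : ℝ) 1, ∫⁻ x, ENNReal.ofReal (‖v t x‖ ^ 2) ∂(α t) := by
  refine le_antisymm ?_ ?_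
  · refine le_iInf₂ fun α v => le_iInf₂ fun hα h0 => le_iInf₂ fun h1 hv => le_iInf fun hcont => ?_
    subst h0 h1
    exact W2sq_le_lintegral_kineticEnergy hα hv hcont
  · refine le_iInf fun π => le_iInf₂ fun h0 h1 => ?_
    by_cases hπ : ∫⁻ p, ENNReal.ofReal (‖p.1 - p.2‖ ^ 2) ∂π = ⊤
    · exact hπ ▸ le_top
    have : IsProbabilityMeasure π := by
      have : IsProbabilityMeasure (π.map Prod.fst) := h0 ▸ inferInstance
      exact Measure.isProbabilityMeasure_of_map Prod.fst
    obtain ⟨v, hv, hcont, hle⟩ := exists_velocity_lineInterp π hπ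
    refine iInf₂_le_of_le (fun t => π.map (lineInterp t)) v (iInf₂_le_of_le (fun t _ =>
      Measure.isProbabilityMeasure_map (measurable_lineInterp t).aemeasurable) ?_
      (iInf₂_le_of_le ?_ hv (iInf_le_of_le hcont hle)))
    · rw [← h0]
      exact congrArg π.map (funext fun p => by simp [lineInterp])
    · rw [← h1]
      exact congrArg π.map (funext fun p => by simp [lineInterp])
end

section
/- Let α₀ and α₁ be probability measures on ℝ^d with finite second moments, with α₀ absolutely continuous with respect to Lebesgue measure, and let T = ∇φ (φ convex, differentiable α₀-a.e.) be the Brenier optimal transport map with T_♯α₀ = α₁. Define α_t := ((1−t)Id + tT)_♯ α₀ for t ∈ [0,1]. Then there exists a Borel velocity field v : [0,1]×ℝ^d → ℝ^d such that for every t ∈ [0,1), v_t((1−t)x + tT(x)) = T(x) − x for α₀-almost every x; the pair (α_t, v_t) satisfies the continuity equation in the weak sense; and its kinetic energy satisfies ∫₀¹ ∫ ‖v_t(x)‖² dα_t(x) dt = ∫ ‖T(x) − x‖² dα₀(x) = W₂²(α₀,α₁). -/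
open MeasureTheory
open scoped ENNReal

section Displacement

variable {E : Type*} [NormedAddCommGroup E] [InnerProductSpace ℝ E]

/-- The gradient of a convex function is a subgradient at every point of differentiability. -/
theorem ConvexOn.add_inner_gradient_le [CompleteSpace E] {φ : E → ℝ}
    (hφ : ConvexOn ℝ Set.univ φ) {x : E} (hx : DifferentiableAt ℝ φ x) (z : E) :
    φ x + inner ℝ (gradient φ x) (z - x) ≤ φ z := by
  have hconv : ConvexOn ℝ Set.univ (fun s : ℝ => φ (AffineMap.lineMap x z s)) := by
    exact hφ.comp_affineMap (AffineMap.lineMap x z)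
  have hderiv : HasDerivAt (fun s : ℝ => φ (AffineMap.lineMap x z s))
      (inner ℝ (gradient φ x) (z - x)) 0 := by
    have h1 : HasFDerivAt φ (InnerProductSpace.toDual ℝ E (gradient φ x))
        (AffineMap.lineMap x z (0 : ℝ)) := by
      simpa using hx.hasGradientAt.hasFDerivAt
    have h2 : HasDerivAt (AffineMap.lineMap x z : ℝ → E) (z - x) 0 :=
      AffineMap.hasDerivAt_lineMap
    exact h1.comp_hasDerivAt (0 : ℝ) h2
  have hslope := hconv.le_slope_of_hasDerivAt (Set.mem_univ 0) (Set.mem_univ 1) one_pos hderiv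
  simp only [slope_def_field, AffineMap.lineMap_apply_one, AffineMap.lineMap_apply_zero, sub_zero,
    div_one] at hslope
  linarith

/-- The gradient of a convex function is monotone. -/
theorem ConvexOn.inner_gradient_sub_nonneg [CompleteSpace E] {φ : E → ℝ}
    (hφ : ConvexOn ℝ Set.univ φ) {x y : E} (hx : DifferentiableAt ℝ φ x)
    (hy : DifferentiableAt ℝ φ y) :
    0 ≤ inner ℝ (gradient φ x - gradient φ y) (x - y) := by
  have h1 := hφ.add_inner_gradient_le hx y
  have h2 := hφ.add_inner_gradient_le hy x
  have h3 : inner ℝ (gradient φ x) (y - x) = - inner ℝ (gradient φ x) (x - y) := by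
    rw [← inner_neg_right, neg_sub]
  rw [inner_sub_left]
  linarith

/-- Displacement interpolation by a monotone map is injective at times before `1`. -/
theorem eq_of_interpolation_eq {T : E → E} {x y : E}
    (hmono : 0 ≤ inner ℝ (T x - T y) (x - y)) {t : ℝ} (ht : t ∈ Set.Ico (0 : ℝ) 1)
    (h : (1 - t) • x + t • T x = (1 - t) • y + t • T y) : x = y := by
  have h0 : (1 - t) • (x - y) + t • (T x - T y) = 0 := by
    rw [smul_sub, smul_sub]
    rw [← sub_eq_zero] at h
    rw [← h]
    abel
  have h1 : (1 - t) * ‖x - y‖ ^ 2 + t * inner ℝ (T x - T y) (x - y) = 0 := by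
    have := congrArg (fun w => inner ℝ w (x - y)) h0
    simpa [inner_add_left, real_inner_smul_left, real_inner_self_eq_norm_sq] using this
  have h2 : 0 ≤ t * inner ℝ (T x - T y) (x - y) := mul_nonneg ht.1 hmono
  have h3 : 0 < 1 - t := sub_pos.2 ht.2
  have h4 : ‖x - y‖ ^ 2 = 0 := by
    have := sq_nonneg ‖x - y‖
    nlinarith
  exact sub_eq_zero.1 (norm_eq_zero.1 (by simpa using h4))

variable [MeasurableSpace E] [BorelSpace E]

theorem measurable_gradient [CompleteSpace E] (φ : E → ℝ) : Measurable (gradient φ) :=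
  (InnerProductSpace.toDual ℝ E).symm.continuous.measurable.comp (measurable_fderiv ℝ φ)

/-- A map which is monotone on a Borel set admits a jointly Borel field of velocities for the
displacement interpolation. -/
theorem exists_measurable_interpolation_velocity [FiniteDimensional ℝ E] {T : E → E}
    (hT : Measurable T) {D : Set E} (hD : MeasurableSet D)
    (hmono : ∀ x ∈ D, ∀ y ∈ D, 0 ≤ inner ℝ (T x - T y) (x - y)) :
    ∃ v : ℝ → E → E, Measurable (Function.uncurry v) ∧
      ∀ t ∈ Set.Ico (0 : ℝ) 1, ∀ x ∈ D, v t ((1 - t) • x + t • T x) = T x - x := by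
  have hS : MeasurableSet (Set.Ico (0 : ℝ) 1 ×ˢ D) := measurableSet_Ico.prod hD
  let F : ↥(Set.Ico (0 : ℝ) 1 ×ˢ D) → ℝ × E :=
    fun p => (p.1.1, (1 - p.1.1) • p.1.2 + p.1.1 • T p.1.2)
  have hF : Measurable F := by fun_prop
  have hinj : Function.Injective F := by
    rintro ⟨⟨t, x⟩, ht, hx⟩ ⟨⟨s, y⟩, hs, hy⟩ h
    obtain ⟨rfl, h2⟩ := Prod.mk.inj h
    have hxy : x = y := eq_of_interpolation_eq (hmono x hx y hy) ht h2
    subst hxy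
    rfl
  have : StandardBorelSpace ↥(Set.Ico (0 : ℝ) 1 ×ˢ D) := hS.standardBorel
  obtain ⟨g, hg, hgF⟩ := (hF.measurableEmbedding hinj).exists_measurable_extend
    (g := fun p => T p.1.2 - p.1.2) (by fun_prop) (fun _ => ⟨0⟩)
  exact ⟨fun t x => g (t, x), hg, fun t ht x hx => congrFun hgF ⟨(t, x), ht, hx⟩⟩

/-- Chain rule along straight lines, integrated against a finite measure. -/
theorem integral_sub_integral_interpolation [FiniteDimensional ℝ E] {μ : Measure E}
    [IsFiniteMeasure μ] {T : E → E} (hT : Measurable T)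
    (hint : Integrable (fun x => T x - x) μ) {f : E → ℝ} (hf : ContDiff ℝ 1 f)
    (hfc : HasCompactSupport f) (s u : ℝ) :
    IntervalIntegrable
        (fun t => ∫ x, fderiv ℝ f ((1 - t) • x + t • T x) (T x - x) ∂μ) volume s u ∧
      (∫ x, f ((1 - u) • x + u • T x) ∂μ) - ∫ x, f ((1 - s) • x + s • T x) ∂μ =
        ∫ t in s..u, ∫ x, fderiv ℝ f ((1 - t) • x + t • T x) (T x - x) ∂μ := by
  have hf' : Continuous (fderiv ℝ f) := hf.continuous_fderiv one_ne_zero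
  obtain ⟨C, hC⟩ := (hfc.fderiv (𝕜 := ℝ)).exists_bound_of_continuous hf'
  obtain ⟨K, hK⟩ := hfc.exists_bound_of_continuous hf.continuous
  have hInt : Integrable (Function.uncurry fun (t : ℝ) x =>
      fderiv ℝ f ((1 - t) • x + t • T x) (T x - x)) ((volume.restrict (Set.uIoc s u)).prod μ) := by
    have hdom : Integrable (fun p : ℝ × E => C * ‖T p.2 - p.2‖)
        ((volume.restrict (Set.uIoc s u)).prod μ) := by
      have : IsFiniteMeasure (volume.restrict (Set.uIoc s u)) :=
        ⟨by simp [Set.uIoc]⟩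
      exact (hint.norm.const_mul C).comp_snd _
    refine hdom.mono' ?_ (Filter.Eventually.of_forall fun p => ?_)
    · have h1 : Measurable fun p : ℝ × E => ((1 - p.1) • p.2 + p.1 • T p.2, T p.2 - p.2) := by
        fun_prop
      have h2 : Continuous fun q : E × E => fderiv ℝ f q.1 q.2 := by fun_prop
      exact (h2.measurable.comp h1).aestronglyMeasurable
    · exact (ContinuousLinearMap.le_opNorm _ _).trans
        (mul_le_mul_of_nonneg_right (hC _) (norm_nonneg _))
  have hbd : ∀ t : ℝ, Integrable (fun x => f ((1 - t) • x + t • T x)) μ := fun t => by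
    have h1 : Measurable fun x => (1 - t) • x + t • T x := by fun_prop
    exact Integrable.of_bound (hf.continuous.measurable.comp h1).aestronglyMeasurable K
      (Filter.Eventually.of_forall fun x => hK _)
  refine ⟨?_, ?_⟩
  · rw [intervalIntegrable_iff]
    exact hInt.integral_prod_left
  · rw [intervalIntegral_integral_swap hInt, ← integral_sub (hbd u) (hbd s)]
    refine integral_congr_ae (Filter.Eventually.of_forall fun x => ?_)
    have hline : ∀ t : ℝ, HasDerivAt (fun t : ℝ => (1 - t) • x + t • T x) (T x - x) t := by
      intro t
      have h1 := (((hasDerivAt_id' t).const_sub 1).smul_const x).fun_add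
        ((hasDerivAt_id' t).smul_const (T x))
      rwa [neg_one_smul, one_smul, neg_add_eq_sub] at h1
    refine (intervalIntegral.integral_eq_sub_of_hasDerivAt (f := fun t : ℝ =>
      f ((1 - t) • x + t • T x)) (fun t _ => ?_) ?_).symm
    · exact ((hf.differentiable one_ne_zero _).hasFDerivAt).comp_hasDerivAt t (hline t)
    · refine Continuous.intervalIntegrable ?_ _ _
      fun_prop

/-- A convex function which is differentiable almost everywhere has a measurable dual potential:
the Fenchel–Young inequality holds almost surely, with equality on the graph of the gradient. -/
theorem exists_measurable_dual_potential [FiniteDimensional ℝ E] {μ : Measure E} {φ : E → ℝ}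
    (hφ : ConvexOn ℝ Set.univ φ) (hdiff : ∀ᵐ x ∂μ, DifferentiableAt ℝ φ x) :
    ∃ ψ : E → ℝ, Measurable ψ ∧
      (∀ᵐ y ∂(μ.map (gradient φ)), ∀ x, inner ℝ x y ≤ φ x + ψ y) ∧
      ∀ᵐ x ∂μ, inner ℝ x (gradient φ x) = φ x + ψ (gradient φ x) := by
  have hcont : Continuous φ := hφ.locallyLipschitz.continuous
  let e : ℕ → E := TopologicalSpace.denseSeq E
  have he : DenseRange e := TopologicalSpace.denseRange_denseSeq E
  have hmeas : ∀ n, Measurable fun y : E => inner ℝ (e n) y - φ (e n) := fun n => by fun_prop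
  have hupper : ∀ x, DifferentiableAt ℝ φ x → ∀ z,
      inner ℝ z (gradient φ x) - φ z ≤ inner ℝ x (gradient φ x) - φ x := by
    intro x hx z
    have h := hφ.add_inner_gradient_le hx z
    rw [inner_sub_right, real_inner_comm z, real_inner_comm x] at h
    linarith
  have hle : ∀ y : E, BddAbove (Set.range fun n => inner ℝ (e n) y - φ (e n)) → ∀ x,
      inner ℝ x y ≤ φ x + ⨆ n, (inner ℝ (e n) y - φ (e n)) := by
    intro y hy x
    refine he.induction_on x (isClosed_le (by fun_prop) (by fun_prop)) fun n => ?_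
    have := le_ciSup hy n
    linarith
  have hbdd : ∀ x, DifferentiableAt ℝ φ x →
      BddAbove (Set.range fun n => inner ℝ (e n) (gradient φ x) - φ (e n)) := by
    rintro x hx
    refine ⟨inner ℝ x (gradient φ x) - φ x, ?_⟩
    rintro _ ⟨n, rfl⟩
    exact hupper x hx (e n)
  refine ⟨fun y => ⨆ n, (inner ℝ (e n) y - φ (e n)), Measurable.iSup hmeas, ?_, ?_⟩
  · have hB : ∀ᵐ y ∂(μ.map (gradient φ)),
        BddAbove (Set.range fun n => inner ℝ (e n) y - φ (e n)) := by
      rw [ae_map_iff (measurable_gradient φ).aemeasurable (measurableSet_bddAbove_range hmeas)]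
      exact hdiff.mono hbdd
    exact hB.mono hle
  · filter_upwards [hdiff] with x hx
    refine le_antisymm (hle _ (hbdd x hx) x) ?_
    have := ciSup_le fun n => hupper x hx (e n)
    linarith

/-- A summand of an integrable sum is integrable if both summands are bounded below by integrable
functions. -/
theorem integrable_left_of_add_of_le {X : Type*} [MeasurableSpace X] {μ : Measure X}
    {a b p q : X → ℝ} (ha : AEStronglyMeasurable a μ) (hab : Integrable (fun x => a x + b x) μ)
    (hp : Integrable p μ) (hq : Integrable q μ) (hpa : ∀ᵐ x ∂μ, p x ≤ a x)
    (hqb : ∀ᵐ x ∂μ, q x ≤ b x) : Integrable a μ := by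
  refine Integrable.mono' (g := fun x => |p x| + |a x + b x - q x|)
    (hp.abs.add (hab.sub hq).abs) ha ?_
  filter_upwards [hpa, hqb] with x h1 h2
  rw [Real.norm_eq_abs, abs_le]
  constructor
  · linarith [neg_abs_le (p x), abs_nonneg (a x + b x - q x)]
  · linarith [le_abs_self (a x + b x - q x), abs_nonneg (p x)]

theorem integrable_of_integrable_norm_sq {X F : Type*} [MeasurableSpace X]
    [NormedAddCommGroup F] {μ : Measure X} [IsFiniteMeasure μ] {g : X → F} (hg : AEStronglyMeasurable g μ)
    (h : Integrable (fun x => ‖g x‖ ^ 2) μ) : Integrable g μ :=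
  ((memLp_two_iff_integrable_sq_norm hg).2 h).integrable one_le_two

theorem ofReal_integral_le_lintegral_ofReal {X : Type*} [MeasurableSpace X] {μ : Measure X}
    {g : X → ℝ} (hg : Integrable g μ) :
    ENNReal.ofReal (∫ x, g x ∂μ) ≤ ∫⁻ x, ENNReal.ofReal (g x) ∂μ := by
  refine ENNReal.ofReal_le_of_le_toReal ?_
  rw [integral_eq_lintegral_pos_part_sub_lintegral_neg_part hg]
  exact sub_le_self _ ENNReal.toReal_nonneg

/-- Gradients of convex functions are optimal for the quadratic cost among all couplings. -/
theorem lintegral_gradient_sub_le_of_coupling [FiniteDimensional ℝ E] {μ : Measure E}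
    [IsProbabilityMeasure μ] {φ : E → ℝ} (hφ : ConvexOn ℝ Set.univ φ)
    (hdiff : ∀ᵐ x ∂μ, DifferentiableAt ℝ φ x) (hμ : Integrable (fun x => ‖x‖ ^ 2) μ)
    (hT : Integrable (fun x => ‖gradient φ x‖ ^ 2) μ) {π : Measure (E × E)}
    (hfst : π.map Prod.fst = μ) (hsnd : π.map Prod.snd = μ.map (gradient φ)) :
    ∫⁻ x, ENNReal.ofReal (‖gradient φ x - x‖ ^ 2) ∂μ ≤
      ∫⁻ p, ENNReal.ofReal (‖p.1 - p.2‖ ^ 2) ∂π := by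
  have hTm := measurable_gradient φ
  have hcont : Continuous φ := hφ.locallyLipschitz.continuous
  obtain ⟨ψ, hψ, hFY, heq⟩ := exists_measurable_dual_potential hφ hdiff
  have hidL : Integrable (fun x : E => x) μ :=
    integrable_of_integrable_norm_sq aestronglyMeasurable_id hμ
  have hTL : Integrable (gradient φ) μ :=
    integrable_of_integrable_norm_sq hTm.aestronglyMeasurable hT
  have hinner : Integrable (fun x => inner ℝ x (gradient φ x)) μ := by
    refine Integrable.mono' (hμ.add hT)
      ((measurable_id.inner hTm).aestronglyMeasurable) (Filter.Eventually.of_forall fun x => ?_)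
    have h1 := norm_inner_le_norm (𝕜 := ℝ) x (gradient φ x)
    simp only [Pi.add_apply]
    nlinarith [sq_nonneg (‖x‖ - ‖gradient φ x‖), sq_nonneg ‖x‖, sq_nonneg ‖gradient φ x‖]
  have hsum : Integrable (fun x => φ x + ψ (gradient φ x)) μ := hinner.congr heq
  obtain ⟨x₀, hx₀⟩ := hdiff.exists
  have hFY' : ∀ᵐ x ∂μ, ∀ z, inner ℝ z (gradient φ x) ≤ φ z + ψ (gradient φ x) :=
    ae_of_ae_map hTm.aemeasurable hFY
  have hlow : Integrable (fun x => φ x₀ + inner ℝ (gradient φ x₀) (x - x₀)) μ :=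
    (integrable_const _).add ((hidL.sub (integrable_const x₀)).const_inner _)
  have hlow' : Integrable (fun x => inner ℝ x₀ (gradient φ x) - φ x₀) μ :=
    (hTL.const_inner x₀).sub (integrable_const _)
  have hlow_le : ∀ᵐ x ∂μ, φ x₀ + inner ℝ (gradient φ x₀) (x - x₀) ≤ φ x :=
    Filter.Eventually.of_forall fun x => hφ.add_inner_gradient_le hx₀ x
  have hlow_le' : ∀ᵐ x ∂μ, inner ℝ x₀ (gradient φ x) - φ x₀ ≤ ψ (gradient φ x) :=
    hFY'.mono fun x h => by linarith [h x₀]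
  have hφi : Integrable φ μ := integrable_left_of_add_of_le hcont.aestronglyMeasurable hsum
    hlow hlow' hlow_le hlow_le'
  have hψi : Integrable (fun x => ψ (gradient φ x)) μ :=
    integrable_left_of_add_of_le (hψ.comp hTm).aestronglyMeasurable
      (hsum.congr (Filter.Eventually.of_forall fun x => add_comm _ _))
      hlow' hlow hlow_le' hlow_le
  have hf : Integrable (fun x => ‖x‖ ^ 2 - 2 * φ x) μ := hμ.sub (hφi.const_mul 2)
  have hg : Integrable (fun x => ‖gradient φ x‖ ^ 2 - 2 * ψ (gradient φ x)) μ :=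
    hT.sub (hψi.const_mul 2)
  have hgm : Measurable fun y : E => ‖y‖ ^ 2 - 2 * ψ y := by fun_prop
  have hg' : Integrable (fun y => ‖y‖ ^ 2 - 2 * ψ y) (μ.map (gradient φ)) :=
    (integrable_map_measure hgm.aestronglyMeasurable hTm.aemeasurable).2 hg
  have hfπ : Integrable (fun p : E × E => ‖p.1‖ ^ 2 - 2 * φ p.1) π := by
    rw [← hfst] at hf
    exact hf.comp_measurable measurable_fst
  have hgπ : Integrable (fun p : E × E => ‖p.2‖ ^ 2 - 2 * ψ p.2) π := by
    rw [← hsnd] at hg'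
    exact hg'.comp_measurable measurable_snd
  have hπeq : ∫ p, ((‖p.1‖ ^ 2 - 2 * φ p.1) + (‖p.2‖ ^ 2 - 2 * ψ p.2)) ∂π =
      ∫ x, ‖gradient φ x - x‖ ^ 2 ∂μ := by
    rw [integral_add hfπ hgπ]
    have h1 : ∫ p, (‖p.1‖ ^ 2 - 2 * φ p.1) ∂π = ∫ x, (‖x‖ ^ 2 - 2 * φ x) ∂μ := by
      rw [← hfst]
      exact (integral_map measurable_fst.aemeasurable
        (by fun_prop : Measurable fun x : E => ‖x‖ ^ 2 - 2 * φ x).aestronglyMeasurable).symm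
    have h2 : ∫ p, (‖p.2‖ ^ 2 - 2 * ψ p.2) ∂π =
        ∫ x, (‖gradient φ x‖ ^ 2 - 2 * ψ (gradient φ x)) ∂μ := by
      rw [← integral_map (f := fun y : E => ‖y‖ ^ 2 - 2 * ψ y) hTm.aemeasurable
        hgm.aestronglyMeasurable, ← hsnd]
      exact (integral_map measurable_snd.aemeasurable hgm.aestronglyMeasurable).symm
    rw [h1, h2, ← integral_add hf hg]
    refine integral_congr_ae (heq.mono fun x hx => ?_)
    simp only
    rw [norm_sub_sq_real, real_inner_comm, hx]
    ring
  have hπle : ∀ᵐ p ∂π,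
      (‖p.1‖ ^ 2 - 2 * φ p.1) + (‖p.2‖ ^ 2 - 2 * ψ p.2) ≤ ‖p.1 - p.2‖ ^ 2 := by
    rw [← hsnd] at hFY
    filter_upwards [ae_of_ae_map measurable_snd.aemeasurable hFY] with p hp
    rw [norm_sub_sq_real]
    linarith [hp p.1]
  have hTint : Integrable (fun x => ‖gradient φ x - x‖ ^ 2) μ := by
    refine (hf.add hg).congr (heq.mono fun x hx => ?_)
    simp only [Pi.add_apply]
    rw [norm_sub_sq_real, real_inner_comm, hx]
    ring
  rw [← ofReal_integral_eq_lintegral_ofReal hTint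
    (Filter.Eventually.of_forall fun x => sq_nonneg _), ← hπeq]
  refine (ofReal_integral_le_lintegral_ofReal (hfπ.add hgπ)).trans
    (lintegral_mono_ae (hπle.mono fun p hp => ENNReal.ofReal_le_ofReal hp))

end Displacement

/-- **McCann/Benamou–Brenier interpolation from the Brenier map.** If `T = ∇φ` is the Brenier
optimal transport map from `α₀` (absolutely continuous, finite second moment) to `α₁` and
`α_t = ((1-t)Id + tT)_♯ α₀`, then there is a Borel velocity field `v` with
`v_t((1-t)x + tT(x)) = T(x) - x` for `α₀`-a.e. `x` (for each `t ∈ [0,1)`), such that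
`(α_t, v_t)` satisfies the continuity equation weakly and its kinetic energy equals
`∫ ‖T(x) - x‖² dα₀(x) = W₂²(α₀, α₁)`. -/
theorem displacement_interpolation_velocity_field
    (d : ℕ) (α₀ α₁ : Measure (EuclideanSpace ℝ (Fin d)))
    [IsProbabilityMeasure α₀] [IsProbabilityMeasure α₁]
    (hm₀ : Integrable (fun x => ‖x‖ ^ 2) α₀) (hm₁ : Integrable (fun x => ‖x‖ ^ 2) α₁)
    (hac : α₀ ≪ volume)
    (φ : EuclideanSpace ℝ (Fin d) → ℝ)
    (hφ : ConvexOn ℝ Set.univ φ)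
    (hφdiff : ∀ᵐ x ∂α₀, DifferentiableAt ℝ φ x)
    (T : EuclideanSpace ℝ (Fin d) → EuclideanSpace ℝ (Fin d))
    (hT : T = gradient φ)
    (hpush : α₀.map T = α₁)
    (α : ℝ → Measure (EuclideanSpace ℝ (Fin d)))
    (hα : ∀ t : ℝ, α t = α₀.map (fun x => (1 - t) • x + t • T x)) :
    ∃ v : ℝ → EuclideanSpace ℝ (Fin d) → EuclideanSpace ℝ (Fin d),
      Measurable (Function.uncurry v) ∧
      (∀ t ∈ Set.Ico (0 : ℝ) 1, ∀ᵐ x ∂α₀, v t ((1 - t) • x + t • T x) = T x - x) ∧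
      SatisfiesContinuityEq α v ∧
      (∫⁻ t in Set.Icc (0 : ℝ) 1, ∫⁻ x, ENNReal.ofReal (‖v t x‖ ^ 2) ∂(α t)) =
        ∫⁻ x, ENNReal.ofReal (‖T x - x‖ ^ 2) ∂α₀ ∧
      (∫⁻ x, ENNReal.ofReal (‖T x - x‖ ^ 2) ∂α₀) = W2sq α₀ α₁ := by
  subst hT
  have hTm := measurable_gradient φ
  have hX : ∀ t : ℝ, Measurable fun x => (1 - t) • x + t • gradient φ x := fun t => by fun_prop
  have hT2 : Integrable (fun x => ‖gradient φ x‖ ^ 2) α₀ := by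
    rw [← hpush] at hm₁
    exact hm₁.comp_measurable hTm
  have hint : Integrable (fun x => gradient φ x - x) α₀ :=
    (integrable_of_integrable_norm_sq hTm.aestronglyMeasurable hT2).sub
      (integrable_of_integrable_norm_sq aestronglyMeasurable_id hm₀)
  obtain ⟨v, hv, hvD⟩ := exists_measurable_interpolation_velocity hTm
    (measurableSet_of_differentiableAt ℝ φ)
    (fun x hx y hy => hφ.inner_gradient_sub_nonneg hx hy)
  have hvt : ∀ t, Measurable (v t) := fun t => hv.comp measurable_prodMk_left
  have hvae : ∀ t ∈ Set.Ico (0 : ℝ) 1,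
      ∀ᵐ x ∂α₀, v t ((1 - t) • x + t • gradient φ x) = gradient φ x - x :=
    fun t ht => hφdiff.mono fun x hx => hvD t ht x hx
  have hne : ∀ᵐ t : ℝ, t ≠ 1 := by simp [ae_iff]
  refine ⟨v, hv, hvae, ?_, ?_, ?_⟩
  · intro f hf hfc
    have hf1 : ContDiff ℝ 1 f := hf.of_le (by exact_mod_cast le_top)
    have hmain := integral_sub_integral_interpolation hTm hint hf1 hfc
    have hα_int : ∀ t, ∫ x, f x ∂(α t) = ∫ x, f ((1 - t) • x + t • gradient φ x) ∂α₀ := fun t => by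
      rw [hα t, integral_map (hX t).aemeasurable hf.continuous.aestronglyMeasurable]
    have hα_vel : ∀ t ∈ Set.Icc (0 : ℝ) 1, t ≠ 1 → ∫ x, fderiv ℝ f x (v t x) ∂(α t) =
        ∫ x, fderiv ℝ f ((1 - t) • x + t • gradient φ x) (gradient φ x - x) ∂α₀ := by
      intro t ht ht1
      have hc : Continuous fun q : EuclideanSpace ℝ (Fin d) × EuclideanSpace ℝ (Fin d) =>
          fderiv ℝ f q.1 q.2 := by
        have := hf1.continuous_fderiv one_ne_zero
        fun_prop
      rw [hα t, integral_map (f := fun x => fderiv ℝ f x (v t x)) (hX t).aemeasurable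
        (hc.measurable.comp (measurable_id.prodMk (hvt t))).aestronglyMeasurable]
      refine integral_congr_ae ((hvae t ⟨ht.1, lt_of_le_of_ne ht.2 ht1⟩).mono fun x hx => ?_)
      simp only [hx]
    have hcongr : ∀ s ∈ Set.Icc (0 : ℝ) 1, ∀ u ∈ Set.Icc (0 : ℝ) 1, ∀ᵐ t, t ∈ Set.uIoc s u →
        ∫ x, fderiv ℝ f ((1 - t) • x + t • gradient φ x) (gradient φ x - x) ∂α₀ =
          ∫ x, fderiv ℝ f x (v t x) ∂(α t) := by
      intro s hs u hu
      filter_upwards [hne] with t ht1 ht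
      exact (hα_vel t (Set.uIcc_subset_Icc hs hu (Set.uIoc_subset_uIcc ht)) ht1).symm
    refine ⟨(hmain 0 1).1.congr_ae ?_, fun s u hs hu => ?_⟩
    · rw [Filter.EventuallyEq, ae_restrict_iff' measurableSet_uIoc]
      exact hcongr 0 (by simp) 1 (by simp)
    · rw [hα_int, hα_int, (hmain s u).2]
      exact intervalIntegral.integral_congr_ae (hcongr s hs u hu)
  · have henergy : ∀ᵐ t : ℝ, t ∈ Set.Icc (0 : ℝ) 1 →
        ∫⁻ x, ENNReal.ofReal (‖v t x‖ ^ 2) ∂(α t) =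
          ∫⁻ x, ENNReal.ofReal (‖gradient φ x - x‖ ^ 2) ∂α₀ := by
      filter_upwards [hne] with t ht1 ht
      have hvm : Measurable fun x => ENNReal.ofReal (‖v t x‖ ^ 2) :=
        ((hvt t).norm.pow_const 2).ennreal_ofReal
      rw [hα t, lintegral_map hvm (hX t)]
      refine lintegral_congr_ae ((hvae t ⟨ht.1, lt_of_le_of_ne ht.2 ht1⟩).mono fun x hx => ?_)
      simp only [hx]
    rw [setLIntegral_congr_fun_ae measurableSet_Icc henergy]
    simp
  · refine le_antisymm ?_ ?_
    · refine le_iInf fun π => le_iInf fun h₁ => le_iInf fun h₂ => ?_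
      exact lintegral_gradient_sub_le_of_coupling hφ hφdiff hm₀ hT2 h₁ (h₂.trans hpush.symm)
    · have hg : Measurable fun x => (x, gradient φ x) := measurable_id.prodMk hTm
      have h₁ : (α₀.map fun x => (x, gradient φ x)).map Prod.fst = α₀ := by
        rw [Measure.map_map measurable_fst hg]
        exact Measure.map_id
      have h₂ : (α₀.map fun x => (x, gradient φ x)).map Prod.snd = α₁ := by
        rw [Measure.map_map measurable_snd hg]
        exact hpush
      refine iInf_le_of_le _ (iInf_le_of_le h₁ (iInf_le_of_le h₂ (le_of_eq ?_)))
      rw [lintegral_map (by fun_prop) hg]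
      simp only [norm_sub_rev]
end

section
/- Let Q, K ∈ ℝ^{d×d}, set V := Q^⊤K, and let α be a compactly supported probability measure on ℝ^d. Define the log-partition potential φ[α](x) := log ∫ e^{⟨Qx, Ky⟩} dα(y) and the attention vector field Γ[α](x) := (∫ e^{⟨Qx, Ky⟩} V y dα(y)) / (∫ e^{⟨Qx, Kz⟩} dα(z)). Then φ[α] is differentiable on ℝ^d and ∇φ[α](x) = Γ[α](x) for every x ∈ ℝ^d; that is, when V = Q^⊤K the self-attention drift is a gradient field. -/
open MeasureTheory Matrix
open scoped ENNReal RealInnerProductSpace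

/-- The linear map on `ℝ^d` induced by a `d × d` matrix. -/
noncomputable def matVec {d : ℕ} (A : Matrix (Fin d) (Fin d) ℝ) (x : EuclideanSpace ℝ (Fin d)) :
    EuclideanSpace ℝ (Fin d) :=
  (EuclideanSpace.equiv (Fin d) ℝ).symm (A.mulVec (EuclideanSpace.equiv (Fin d) ℝ x))

/-- The self-attention vector field
`Γ_θ[α](x) = (∫ e^{⟨Qx,Ky⟩} V y dα(y)) / (∫ e^{⟨Qx,Kz⟩} dα(z))`. -/
noncomputable def attnField {d : ℕ} (Q K V : Matrix (Fin d) (Fin d) ℝ)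
    (α : Measure (EuclideanSpace ℝ (Fin d))) (x : EuclideanSpace ℝ (Fin d)) :
    EuclideanSpace ℝ (Fin d) :=
  (∫ z, Real.exp ⟪matVec Q x, matVec K z⟫ ∂α)⁻¹ •
    ∫ y, Real.exp ⟪matVec Q x, matVec K y⟫ • matVec V y ∂α

/-- The log-partition potential `φ[α](x) = log ∫ e^{⟨Qx,Ky⟩} dα(y)`. -/
noncomputable def logPartition {d : ℕ} (Q K : Matrix (Fin d) (Fin d) ℝ)
    (α : Measure (EuclideanSpace ℝ (Fin d))) (x : EuclideanSpace ℝ (Fin d)) : ℝ :=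
  Real.log (∫ y, Real.exp ⟪matVec Q x, matVec K y⟫ ∂α)

theorem continuous_matVec {d : ℕ} (A : Matrix (Fin d) (Fin d) ℝ) : Continuous (matVec A) :=
  (Matrix.toEuclideanCLM (n := Fin d) (𝕜 := ℝ) A).continuous

theorem inner_matVec_matVec {d : ℕ} (A B : Matrix (Fin d) (Fin d) ℝ)
    (x y : EuclideanSpace ℝ (Fin d)) :
    ⟪matVec A x, matVec B y⟫ = ⟪x, matVec (Aᵀ * B) y⟫ := by
  change (B *ᵥ y.ofLp) ⬝ᵥ (A *ᵥ x.ofLp) = ((Aᵀ * B) *ᵥ y.ofLp) ⬝ᵥ x.ofLp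
  rw [← mulVec_mulVec, mulVec_transpose, dotProduct_mulVec]

/-- Differentiation under the integral sign for the moment generating function of an
almost surely bounded random vector. -/
theorem hasGradientAt_integral_exp_inner {Ω E : Type*} [MeasurableSpace Ω]
    [NormedAddCommGroup E] [InnerProductSpace ℝ E] [CompleteSpace E]
    {μ : Measure Ω} [IsFiniteMeasure μ] {g : Ω → E} (hg : AEStronglyMeasurable g μ)
    {B : ℝ} (hB : ∀ᵐ y ∂μ, ‖g y‖ ≤ B) (x : E) :
    HasGradientAt (fun x ↦ ∫ y, Real.exp ⟪x, g y⟫ ∂μ) (∫ y, Real.exp ⟪x, g y⟫ • g y ∂μ) x := by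
  have hmeas (z : E) : AEStronglyMeasurable (fun y ↦ Real.exp ⟪z, g y⟫) μ :=
    Real.continuous_exp.comp_aestronglyMeasurable (aestronglyMeasurable_const.inner hg)
  have hexp {z : E} (hz : ‖z‖ ≤ ‖x‖ + 1) {y : Ω} (hy : ‖g y‖ ≤ B) :
      Real.exp ⟪z, g y⟫ ≤ Real.exp ((‖x‖ + 1) * B) :=
    Real.exp_le_exp.2 <| (real_inner_le_norm _ _).trans <|
      mul_le_mul hz hy (norm_nonneg _) (by positivity)
  have hbound {z : E} (hz : ‖z‖ ≤ ‖x‖ + 1) {y : Ω} (hy : ‖g y‖ ≤ B) :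
      ‖Real.exp ⟪z, g y⟫ • g y‖ ≤ Real.exp ((‖x‖ + 1) * B) * B := by
    rw [norm_smul, Real.norm_eq_abs, Real.abs_exp]
    exact mul_le_mul (hexp hz hy) hy (norm_nonneg _) (Real.exp_nonneg _)
  have hx : ‖x‖ ≤ ‖x‖ + 1 := by linarith
  have hball {z : E} (hz : z ∈ Metric.ball x 1) : ‖z‖ ≤ ‖x‖ + 1 := by
    have := norm_le_norm_add_norm_sub' z x
    have := mem_ball_iff_norm.1 hz
    linarith
  have hint : Integrable (fun y ↦ Real.exp ⟪x, g y⟫ • g y) μ :=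
    .of_bound ((hmeas x).smul hg) _ (hB.mono fun y hy ↦ hbound hx hy)
  rw [hasGradientAt_iff_hasFDerivAt]
  have key := hasFDerivAt_integral_of_dominated_of_fderiv_le (𝕜 := ℝ) (μ := μ)
    (F := fun z y ↦ Real.exp ⟪z, g y⟫)
    (F' := fun z y ↦ InnerProductSpace.toDual ℝ E (Real.exp ⟪z, g y⟫ • g y))
    (bound := fun _ ↦ Real.exp ((‖x‖ + 1) * B) * B)
    (Metric.ball_mem_nhds x one_pos) (.of_forall hmeas)
    (.of_bound (hmeas x) (Real.exp ((‖x‖ + 1) * B)) (hB.mono fun y hy ↦ by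
      rw [Real.norm_eq_abs, Real.abs_exp]; exact hexp hx hy))
    ((InnerProductSpace.toDual ℝ E).continuous.comp_aestronglyMeasurable ((hmeas x).smul hg))
    (hB.mono fun y hy z hz ↦ by
      rw [LinearIsometryEquiv.norm_map]; exact hbound (hball hz) hy)
    (integrable_const _)
    (.of_forall fun y z _ ↦ by
      refine ((hasFDerivAt_id z).inner ℝ (hasFDerivAt_const (g y) z)).exp.congr_fderiv ?_
      ext v
      simp [real_inner_comm])
  exact key.congr_fderiv <| ContinuousLinearMap.integral_comp_comm
    (InnerProductSpace.toDual ℝ E).toContinuousLinearEquiv.toContinuousLinearMap hint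

/-- **When `V = Q^⊤K` the self-attention drift is a gradient field:** the log-partition
potential `φ[α]` is differentiable everywhere with `∇φ[α](x) = Γ_θ[α](x)` for any
compactly supported token distribution `α`. -/
theorem attention_is_gradient_field
    (d : ℕ) (Q K V : Matrix (Fin d) (Fin d) ℝ) (hV : V = Qᵀ * K)
    (α : Measure (EuclideanSpace ℝ (Fin d))) [IsProbabilityMeasure α]
    (hsupp : ∃ C : Set (EuclideanSpace ℝ (Fin d)), IsCompact C ∧ α Cᶜ = 0) :
    ∀ x, HasGradientAt (logPartition Q K α) (attnField Q K V α x) x := by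
  intro x
  obtain ⟨C, hC, hC0⟩ := hsupp
  obtain ⟨B, hB⟩ := hC.exists_bound_of_continuousOn (continuous_matVec V).continuousOn
  have hae : ∀ᵐ y ∂α, ‖matVec V y‖ ≤ B :=
    Filter.Eventually.mono (mem_ae_iff.2 hC0) hB
  have hmeas := (continuous_matVec V).aestronglyMeasurable (μ := α)
  have hgrad := hasGradientAt_integral_exp_inner hmeas hae x
  have hint : Integrable (fun y ↦ Real.exp ⟪x, matVec V y⟫) α :=
    .of_bound (Real.continuous_exp.comp_aestronglyMeasurable
      (aestronglyMeasurable_const.inner hmeas)) (Real.exp (‖x‖ * B)) <| hae.mono fun y hy ↦ by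
        rw [Real.norm_eq_abs, Real.abs_exp]
        exact Real.exp_le_exp.2 <| (real_inner_le_norm _ _).trans <| by gcongr
  have hpos : 0 < ∫ y, Real.exp ⟪x, matVec V y⟫ ∂α := integral_exp_pos hint
  have hlog := hgrad.hasFDerivAt.log hpos.ne'
  rw [hasGradientAt_iff_hasFDerivAt]
  unfold logPartition attnField
  simp only [inner_matVec_matVec, ← hV]
  simpa using hlog
end
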